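/- For every n ≥ 1 and all 0 < r < R, one has c_HZ(B_R, B̄_r) = π(R² − r²), where B_R ⊂ ℝ^{2n} is the open ball of radius R and B̄_r is the closed ball of radius r, both centered at the origin. -/

import Mathlib

open scoped RealInnerProductSpace ENNReal NNReal Topology
open Metric Set

noncomputable section

/-- `ℝ^{2n}` identified with `ℂ^n`, with the standard (real) inner product and
the standard complex structure `J` given by multiplication by `i`. -/
abbrev Esp (n : ℕ) := EuclideanSpace ℂ (Fin n)

variable {n : ℕ}

/-- The Hamiltonian vector field `X_H = J ∇H` of `H : ℝ^{2n} → ℝ`. -/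
def hamVF (H : Esp n → ℝ) (x : Esp n) : Esp n := Complex.I • gradient H x

/-- A nonconstant `T`-periodic orbit of the Hamiltonian flow of `H`:
a nonconstant solution `γ` of `γ' = J∇H(γ)` with `γ (t + T) = γ t`. -/
def IsPeriodicOrbit (H : Esp n → ℝ) (γ : ℝ → Esp n) (T : ℝ) : Prop :=
  0 < T ∧ (∀ t, HasDerivAt γ (hamVF H (γ t)) t) ∧
    (∀ t, γ (t + T) = γ t) ∧ ∃ t₀ t₁, γ t₀ ≠ γ t₁

/-- `H` has a fast (period `≤ 1`) nonconstant periodic orbit. -/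
def HasFastOrbit (H : Esp n → ℝ) : Prop :=
  ∃ γ T, IsPeriodicOrbit H γ T ∧ T ≤ 1

/-- The symplectic action of a `1`-periodic loop `γ` with respect to the
(possibly time-dependent) Hamiltonian `H`:
`A_H(γ) = -(1/2)∫₀¹ ⟨Jγ(t), γ'(t)⟩ dt + ∫₀¹ H(t, γ(t)) dt`. -/
def action (H : ℝ → Esp n → ℝ) (γ : ℝ → Esp n) : ℝ :=
  -(1 / 2) * (∫ t in (0:ℝ)..1, ⟪(Complex.I • γ t : Esp n), deriv γ t⟫) +
    ∫ t in (0:ℝ)..1, H t (γ t)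

/-- The class `𝓗(V, Z)`: smooth functions on `ℝ^{2n}` with compact support
contained in `V`, constant on a neighborhood of `Z`, whose value on `Z` is the
maximum of `H`. -/
def InHclass (V Z : Set (Esp n)) (H : Esp n → ℝ) : Prop :=
  ContDiff ℝ (⊤ : ℕ∞) H ∧ IsCompact (tsupport H) ∧ tsupport H ⊆ V ∧
    (∃ U, IsOpen U ∧ Z ⊆ U ∧ ∃ c : ℝ, ∀ x ∈ U, H x = c) ∧
    ∀ z ∈ Z, ∀ x, H x ≤ H z

/-- The relative Hofer–Zehnder capacity `c_HZ(V, Z)`: the supremum of `max H`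
over all `H ∈ 𝓗(V, Z)` having no fast nonconstant periodic orbit (for `z ∈ Z`,
`H z = max H`). -/
def relCap (V Z : Set (Esp n)) : ℝ≥0∞ :=
  sSup {c | ∃ H, InHclass V Z H ∧ ¬ HasFastOrbit H ∧
    ∃ z ∈ Z, c = ENNReal.ofReal (H z)}

namespace HZ
open MeasureTheory

section Brouwer

lemma det_interp {V : Type*} [NormedAddCommGroup V] [NormedSpace ℝ V] [FiniteDimensional ℝ V]
    (s : Finset ℝ) (hs : Module.finrank ℝ V < s.card) (A : V →L[ℝ] V) :
    (1 + A : V →L[ℝ] V).det =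
      ∑ t ∈ s, ((Lagrange.basis s id t).eval 1) * (1 + t • A : V →L[ℝ] V).det := by
  classical
  let b := Module.finBasis ℝ V
  let M := LinearMap.toMatrix b b (A : V →ₗ[ℝ] V)
  let p : Polynomial ℝ := Matrix.det ((Polynomial.X : Polynomial ℝ) • M.map Polynomial.C +
    (1 : Matrix _ _ ℝ).map Polynomial.C)
  have hp : ∀ t : ℝ, p.eval t = (1 + t • A : V →L[ℝ] V).det := by
    intro t
    have : (1 + t • A : V →L[ℝ] V).det = Matrix.det (1 + t • M) := by
      rw [ContinuousLinearMap.det, ← LinearMap.det_toMatrix b]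
      congr 1
      have : ((1 + t • A : V →L[ℝ] V) : V →ₗ[ℝ] V) = LinearMap.id + t • (A : V →ₗ[ℝ] V) := by
        ext x; simp
      rw [this, map_add, map_smul, LinearMap.toMatrix_id]
    rw [this]
    simp only [p]
    rw [← Polynomial.coe_evalRingHom, RingHom.map_det]
    congr 1
    ext i j
    by_cases hij : i = j <;> simp [hij, add_comm] <;> ring
  have hdeg : p.degree < s.card := by
    refine lt_of_le_of_lt Polynomial.degree_le_natDegree ?_
    have := Polynomial.natDegree_det_X_add_C_le M (1 : Matrix _ _ ℝ)
    rw [Fintype.card_fin] at this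
    exact_mod_cast lt_of_le_of_lt this hs
  have h1 : (1 + A : V →L[ℝ] V).det = p.eval 1 := by rw [hp, one_smul]
  rw [h1, Lagrange.eq_interpolate (s := s) (v := id) (Set.injOn_id _) hdeg,
    Lagrange.interpolate_apply, Polynomial.eval_finsetSum]
  refine Finset.sum_congr rfl fun t _ => ?_
  rw [Polynomial.eval_mul, Polynomial.eval_C, id, hp, mul_comm]

variable {V : Type*} [NormedAddCommGroup V] [InnerProductSpace ℝ V] [FiniteDimensional ℝ V]
  [MeasurableSpace V] [BorelSpace V]

lemma exists_det_pos : ∃ δ > 0, ∀ A : V →L[ℝ] V, ‖A‖ < δ → 0 < (1 + A : V →L[ℝ] V).det := by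
  have hc : Continuous fun A : V →L[ℝ] V => (1 + A : V →L[ℝ] V).det :=
    ContinuousLinearMap.continuous_det.comp (continuous_const.add continuous_id)
  have h0 : (0:ℝ) < (1 + (0 : V →L[ℝ] V) : V →L[ℝ] V).det := by
    simp [ContinuousLinearMap.det]
  have := (hc.tendsto 0).eventually (lt_mem_nhds h0)
  rw [Metric.eventually_nhds_iff] at this
  obtain ⟨δ, hδ, h⟩ := this
  exact ⟨δ, hδ, fun A hA => h (by simpa using hA)⟩

lemma small_change (w : V → V) (C : ℝ≥0) (hw : LipschitzWith C w) (ρ : ℝ)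
    (hw0 : ∀ x, x ∉ ball (0:V) ρ → w x = 0)
    (hd : ∀ x ∈ ball (0:V) ρ, DifferentiableAt ℝ w x) :
    ∃ t₀ > (0:ℝ), ∀ t, 0 < t → t < t₀ →
      ∫ x in ball (0:V) ρ, (1 + t • fderiv ℝ w x : V →L[ℝ] V).det = volume.real (ball (0:V) ρ) := by
  obtain ⟨δ, hδ, hdet⟩ := exists_det_pos (V := V)
  refine ⟨min δ 1 / (C + 1), by positivity, fun t ht htt => ?_⟩
  have hC : (0:ℝ) < C + 1 := by positivity
  rw [lt_div_iff₀ hC] at htt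
  have h1 : t * C < δ := by
    have := min_le_left δ 1
    nlinarith
  have h2 : t * C < 1 := by
    have := min_le_right δ 1
    nlinarith
  let f : V → V := fun x => x + t • w x
  have happ : ApproximatesLinearOn f ((ContinuousLinearEquiv.refl ℝ V : V ≃L[ℝ] V) : V →L[ℝ] V)
      univ (⟨t, ht.le⟩ * C) := by
    intro x _ y _
    simp only [f, ContinuousLinearEquiv.coe_refl, ContinuousLinearMap.id_apply]
    have : x + t • w x - (y + t • w y) - (x - y) = t • (w x - w y) := by
      rw [smul_sub]; abel
    have e : ‖t • (w x - w y)‖ ≤ t * C * ‖x - y‖ := by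
      rw [norm_smul, Real.norm_of_nonneg ht.le, mul_assoc]
      exact mul_le_mul_of_nonneg_left (hw.norm_sub_le x y) ht.le
    rw [this]; exact e
  have hcc : Subsingleton V ∨ (⟨t, ht.le⟩ * C : ℝ≥0) <
      ‖((ContinuousLinearEquiv.refl ℝ V).symm : V →L[ℝ] V)‖₊⁻¹ := by
    rcases subsingleton_or_nontrivial V with h | h
    · exact Or.inl h
    · right
      have : ‖((ContinuousLinearEquiv.refl ℝ V).symm : V →L[ℝ] V)‖₊ = 1 := by
        ext; simp
      rw [this, inv_one]
      exact_mod_cast h2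
  have hinj : InjOn f univ := happ.injOn hcc
  have hsurj : Function.Surjective f := happ.surjective hcc
  have himg : f '' (ball (0:V) ρ) = ball (0:V) ρ := by
    have hout : ∀ x, x ∉ ball (0:V) ρ → f x = x := fun x hx => by simp [f, hw0 x hx]
    ext y
    constructor
    · rintro ⟨x, hx, rfl⟩
      by_contra hn
      have := hinj (mem_univ _) (mem_univ _) (hout _ hn)
      rw [this] at hn
      exact hn hx
    · intro hy
      obtain ⟨x, rfl⟩ := hsurj y
      refine ⟨x, ?_, rfl⟩
      by_contra hn
      rw [hout x hn] at hy
      exact hn hy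
  have hder : ∀ x ∈ ball (0:V) ρ,
      HasFDerivWithinAt f (1 + t • fderiv ℝ w x : V →L[ℝ] V) (ball (0:V) ρ) x := by
    intro x hx
    exact ((hasFDerivAt_id x).add ((hd x hx).hasFDerivAt.const_smul t)).hasFDerivWithinAt
  have key := integral_image_eq_integral_abs_det_fderiv_smul volume measurableSet_ball hder
    (hinj.mono (subset_univ _)) (fun _ => (1:ℝ))
  rw [himg] at key
  simp only [integral_const, smul_eq_mul, mul_one, measureReal_restrict_apply_univ] at key
  rw [key]
  refine setIntegral_congr_fun measurableSet_ball fun x hx => ?_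
  rw [abs_of_pos]
  apply hdet
  calc ‖t • fderiv ℝ w x‖ = t * ‖fderiv ℝ w x‖ := by rw [norm_smul, Real.norm_of_nonneg ht.le]
    _ ≤ t * C := mul_le_mul_of_nonneg_left (norm_fderiv_le_of_lipschitz ℝ hw) ht.le
    _ < δ := h1

lemma null_lagrangian (w : V → V) (C : ℝ≥0) (hw : LipschitzWith C w) (ρ : ℝ)
    (hw0 : ∀ x, x ∉ ball (0:V) ρ → w x = 0)
    (hd : ∀ x ∈ ball (0:V) ρ, DifferentiableAt ℝ w x) :
    ∫ x in ball (0:V) ρ, (1 + fderiv ℝ w x : V →L[ℝ] V).det = volume.real (ball (0:V) ρ) := by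
  obtain ⟨t₀, ht₀, h⟩ := small_change w C hw ρ hw0 hd
  obtain ⟨s, hs1, hs2⟩ := (Set.Ioo_infinite ht₀).exists_subset_card_eq (Module.finrank ℝ V + 1)
  have hcard : Module.finrank ℝ V < s.card := by omega
  have hintg : ∀ t : ℝ, IntegrableOn (fun x => (1 + t • fderiv ℝ w x : V →L[ℝ] V).det)
      (ball (0:V) ρ) := by
    intro t
    have hc : Continuous fun A : V →L[ℝ] V => (1 + t • A : V →L[ℝ] V).det :=
      ContinuousLinearMap.continuous_det.comp (continuous_const.add (continuous_id.const_smul t))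
    obtain ⟨B, hB⟩ := (isCompact_closedBall (0 : V →L[ℝ] V) C).exists_bound_of_continuousOn
      hc.continuousOn
    refine Measure.integrableOn_of_bounded (M := B) measure_ball_lt_top.ne ?_ ?_
    · exact (hc.measurable.comp (measurable_fderiv ℝ w)).aestronglyMeasurable
    · refine Filter.Eventually.of_forall fun x => hB _ ?_
      simpa using norm_fderiv_le_of_lipschitz ℝ hw
  have hfun : (fun x => (1 + fderiv ℝ w x : V →L[ℝ] V).det) = fun x =>
      ∑ t ∈ s, ((Lagrange.basis s id t).eval 1) * (1 + t • fderiv ℝ w x : V →L[ℝ] V).det :=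
    funext fun x => det_interp s hcard _
  rw [hfun]
  rw [integral_finsetSum _ fun t _ => (hintg t).const_mul _]
  simp_rw [integral_const_mul]
  have : ∀ t ∈ s, (Lagrange.basis s id t).eval 1 *
      ∫ x in ball (0:V) ρ, (1 + t • fderiv ℝ w x : V →L[ℝ] V).det =
      (Lagrange.basis s id t).eval 1 * volume.real (ball (0:V) ρ) := by
    intro t ht
    rw [h t (hs1 ht).1 (hs1 ht).2]
  rw [Finset.sum_congr rfl this, ← Finset.sum_mul, ← Polynomial.eval_finsetSum,
    Lagrange.sum_basis (Set.injOn_id _) (Finset.card_pos.1 (by omega))]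
  simp

/-- No `C¹` retraction, in the form needed: a map `w` that is `C¹` near the closed ball, zero on the
sphere, cannot have `id + w` valued in the sphere. -/
lemma no_retraction (w : V → V) (ρ : ℝ) (hρ : 0 < ρ)
    (hw : ∀ x ∈ closedBall (0:V) ρ, ContDiffAt ℝ 1 w x)
    (hw0 : ∀ x, ‖x‖ = ρ → w x = 0)
    (hs : ∀ x ∈ closedBall (0:V) ρ, ‖x + w x‖ = ρ) : False := by
  classical
  -- Lipschitz on the closed ball
  have hlip : ∃ C : ℝ≥0, LipschitzOnWith C w (closedBall (0:V) ρ) := by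
    have hcont : ContinuousOn (fun x => fderiv ℝ w x) (closedBall (0:V) ρ) := fun x hx =>
      ((hw x hx).continuousAt_fderiv one_ne_zero).continuousWithinAt
    obtain ⟨B, hB⟩ := (isCompact_closedBall (0 : V) ρ).exists_bound_of_continuousOn hcont
    refine ⟨B.toNNReal, Convex.lipschitzOnWith_of_nnnorm_fderiv_le (𝕜 := ℝ)
      (fun x hx => (hw x hx).differentiableAt one_ne_zero) (fun x hx => ?_)
      (convex_closedBall 0 ρ)⟩
    rw [← NNReal.coe_le_coe, coe_nnnorm, Real.coe_toNNReal']
    exact (hB x hx).trans (le_max_left _ _)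
  obtain ⟨C, hC⟩ := hlip
  let W : V → V := fun x => if ‖x‖ ≤ ρ then w x else 0
  have hWin : ∀ x, ‖x‖ ≤ ρ → W x = w x := fun x hx => if_pos hx
  have hWout : ∀ x, ¬ ‖x‖ ≤ ρ → W x = 0 := fun x hx => if_neg hx
  -- mixed estimate
  have hmix : ∀ x y, ‖x‖ ≤ ρ → ¬ ‖y‖ ≤ ρ → dist (W x) (W y) ≤ C * dist x y := by
    intro x y hx hy
    push Not at hy
    have hcont : ContinuousOn (fun t : ℝ => ‖x + t • (y - x)‖) (Icc 0 1) := by fun_prop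
    have := intermediate_value_Icc zero_le_one hcont
    have hmem : ρ ∈ Icc (‖x + (0:ℝ) • (y - x)‖) (‖x + (1:ℝ) • (y - x)‖) := by
      simp [hx, hy.le]
    obtain ⟨t, ht, htρ⟩ := this hmem
    simp only at htρ
    set z := x + t • (y - x) with hz
    have h1 : W y = w z := by rw [hWout y (not_le.2 hy), hw0 z htρ]
    rw [hWin x hx, h1]
    refine (hC.dist_le_mul x (by simpa using hx) z (by simp [htρ])).trans ?_
    refine mul_le_mul_of_nonneg_left ?_ C.2
    rw [hz, dist_eq_norm, dist_eq_norm]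
    have : x - (x + t • (y - x)) = t • (x - y) := by
      rw [smul_sub, smul_sub]; abel
    rw [this, norm_smul, Real.norm_of_nonneg ht.1]
    exact mul_le_of_le_one_left (norm_nonneg _) ht.2
  have hWlip : LipschitzWith C W := by
    refine LipschitzWith.of_dist_le_mul fun x y => ?_
    by_cases hx : ‖x‖ ≤ ρ <;> by_cases hy : ‖y‖ ≤ ρ
    · rw [hWin x hx, hWin y hy]
      exact hC.dist_le_mul x (by simpa using hx) y (by simpa using hy)
    · exact hmix x y hx hy
    · rw [dist_comm, dist_comm x]; exact hmix y x hy hx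
    · rw [hWout x hx, hWout y hy, dist_self]; positivity
  have hev : ∀ x ∈ ball (0:V) ρ, W =ᶠ[𝓝 x] w := by
    intro x hx
    filter_upwards [isOpen_ball.mem_nhds hx] with y hy
    exact hWin y (by simpa using (mem_ball_zero_iff.1 hy).le)
  have hd : ∀ x ∈ ball (0:V) ρ, DifferentiableAt ℝ W x := fun x hx =>
    (((hw x (ball_subset_closedBall hx)).differentiableAt one_ne_zero)).congr_of_eventuallyEq
      (hev x hx)
  have key := null_lagrangian W C hWlip ρ (by
    intro x hx
    rw [mem_ball_zero_iff, not_lt] at hx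
    rcases hx.eq_or_lt with h | h
    · rw [hWin x h.ge, hw0 x h.symm]
    · exact hWout x (not_le.2 h)) hd
  have hzero : ∀ x ∈ ball (0:V) ρ, (1 + fderiv ℝ W x : V →L[ℝ] V).det = 0 := by
    intro x hx
    have hr : HasFDerivAt (fun y => y + W y) (1 + fderiv ℝ W x : V →L[ℝ] V) x :=
      (hasFDerivAt_id x).add (hd x hx).hasFDerivAt
    have hsq := hr.norm_sq
    have hc : (fun y => ‖y + W y‖ ^ 2) =ᶠ[𝓝 x] fun _ => ρ ^ 2 := by
      filter_upwards [isOpen_ball.mem_nhds hx] with y hy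
      have hy' := (mem_ball_zero_iff.1 hy).le
      rw [hWin y hy', hs y (by simpa using hy')]
    have h0 := hsq.unique ((hasFDerivAt_const (ρ ^ 2) x).congr_of_eventuallyEq hc)
    by_contra hne
    have hsurj : Function.Surjective (1 + fderiv ℝ W x : V →L[ℝ] V) := by
      have hu := (LinearMap.isUnit_iff_isUnit_det
        ((1 + fderiv ℝ W x : V →L[ℝ] V) : V →ₗ[ℝ] V)).2 (isUnit_iff_ne_zero.2 hne)
      exact ((Module.End.isUnit_iff _).1 hu).2
    obtain ⟨v, hv⟩ := hsurj (x + W x)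
    have h1 := DFunLike.congr_fun h0 v
    have hx' := (mem_ball_zero_iff.1 hx).le
    have h2 : ‖x + W x‖ = ρ := by rw [hWin x hx', hs x (by simpa using hx')]
    simp only [smul_apply, ContinuousLinearMap.comp_apply, innerSL_apply_apply, hv,
      real_inner_self_eq_norm_sq, h2, zero_apply] at h1
    simp [hρ.ne'] at h1
  rw [setIntegral_congr_fun measurableSet_ball hzero, integral_zero] at key
  have hpos : 0 < volume.real (ball (0:V) ρ) :=
    ENNReal.toReal_pos (measure_ball_pos volume 0 hρ).ne' measure_ball_lt_top.ne
  exact hpos.ne key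

end Brouwer

section Brouwer2
variable {V : Type*} [NormedAddCommGroup V] [InnerProductSpace ℝ V] [FiniteDimensional ℝ V]

lemma brouwer_smooth (T : V → V) (hT : ContDiff ℝ 1 T) (ρ : ℝ) (hρ : 0 < ρ)
    (hb : ∀ x, ‖T x‖ < ρ) : ∃ x ∈ closedBall (0:V) ρ, T x = x := by
  by_contra hno
  push Not at hno
  borelize V
  let u : V → V := fun x => x - T x
  have hu : ContDiff ℝ 1 u := contDiff_id.sub hT
  have hune : ∀ x ∈ closedBall (0:V) ρ, u x ≠ 0 := fun x hx h => hno x hx (sub_eq_zero.1 h).symm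
  let D : V → ℝ := fun x => ⟪x, u x⟫ ^ 2 + ‖u x‖ ^ 2 * (ρ ^ 2 - ‖x‖ ^ 2)
  let l : V → ℝ := fun x => (-⟪x, u x⟫ + √(D x)) / ‖u x‖ ^ 2
  have hxu : ∀ x, ‖x‖ = ρ → 0 < ⟪x, u x⟫ := by
    intro x hx
    simp only [u, inner_sub_right, real_inner_self_eq_norm_sq]
    have := real_inner_le_norm x (T x)
    have h2 := hb x
    rw [hx] at *
    nlinarith
  have hD : ∀ x ∈ closedBall (0:V) ρ, 0 < D x := by
    intro x hx
    rw [mem_closedBall_zero_iff] at hx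
    rcases hx.eq_or_lt with h | h
    · have := hxu x h
      simp only [D, h, sub_self, mul_zero, add_zero]
      positivity
    · have h1 : 0 < ‖u x‖ := norm_pos_iff.2 (hune x (by simpa using hx))
      have h2 : 0 < ρ ^ 2 - ‖x‖ ^ 2 := by nlinarith [norm_nonneg x]
      simp only [D]
      positivity
  have hDc : ContDiff ℝ 1 D :=
    ((contDiff_id.inner ℝ hu).pow 2).add ((hu.norm_sq ℝ).mul (contDiff_const.sub (contDiff_id.norm_sq ℝ)))
  refine no_retraction (fun x => l x • u x) ρ hρ (fun x hx => ?_) (fun x hx => ?_) (fun x hx => ?_)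
  · have h1 : ContDiffAt ℝ 1 l x :=
      ((contDiff_id.inner ℝ hu).neg.contDiffAt.add (hDc.contDiffAt.sqrt (hD x hx).ne')).div
        (hu.norm_sq ℝ).contDiffAt (by simpa using hune x hx)
    exact h1.smul hu.contDiffAt
  · have : l x = 0 := by
      simp only [l, D, hx, sub_self, mul_zero, add_zero]
      rw [Real.sqrt_sq (hxu x hx).le]; simp
    simp [this]
  · have hn : ‖u x‖ ^ 2 ≠ 0 := by simpa using hune x hx
    have hsq : √(D x) ^ 2 = D x := Real.sq_sqrt (hD x hx).le
    have : ‖x + l x • u x‖ ^ 2 = ρ ^ 2 := by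
      rw [norm_add_sq_real, inner_smul_right, norm_smul, mul_pow, Real.norm_eq_abs, sq_abs]
      have hl : l x * ‖u x‖ ^ 2 = -⟪x, u x⟫ + √(D x) := div_mul_cancel₀ _ hn
      have e : (‖x‖ ^ 2 + 2 * (l x * ⟪x, u x⟫) + l x ^ 2 * ‖u x‖ ^ 2) * ‖u x‖ ^ 2 =
          ρ ^ 2 * ‖u x‖ ^ 2 := by
        have : (‖x‖ ^ 2 + 2 * (l x * ⟪x, u x⟫) + l x ^ 2 * ‖u x‖ ^ 2) * ‖u x‖ ^ 2 =
          ‖x‖ ^ 2 * ‖u x‖ ^ 2 + 2 * (l x * ‖u x‖ ^ 2) * ⟪x, u x⟫ + (l x * ‖u x‖ ^ 2) ^ 2 := by ring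
        rw [this, hl]
        have e2 : ∀ a b : ℝ, (-a + b) ^ 2 = a ^ 2 - 2 * a * b + b ^ 2 := by intros; ring
        rw [e2, hsq]
        simp only [D]; ring
      exact mul_right_cancel₀ hn e
    exact (sq_eq_sq₀ (norm_nonneg _) hρ.le).1 this

lemma brouwer_inner (T : V → V) (hT : Continuous T) (B : ℝ)
    (hb : ∀ x, ‖T x‖ ≤ B) : ∃ x, T x = x := by
  by_contra hno
  push Not at hno
  have hB : 0 ≤ B := (norm_nonneg _).trans (hb 0)
  obtain ⟨x₀, -, hx₀⟩ := (isCompact_closedBall (0:V) (B + 1)).exists_isMinOn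
    ⟨0, by simp; linarith⟩ (f := fun x => ‖T x - x‖) (by fun_prop)
  have hpos : 0 < ‖T x₀ - x₀‖ := norm_pos_iff.2 (sub_ne_zero.2 (hno x₀))
  set ε := min 1 ‖T x₀ - x₀‖ with hε
  have hεpos : 0 < ε := lt_min one_pos hpos
  obtain ⟨g, hg, hgT, -⟩ := hT.exists_contDiff_approx 1 (ε := fun _ => ε) continuous_const
    (fun _ => hεpos)
  obtain ⟨x, hx, hgx⟩ := brouwer_smooth g (by exact_mod_cast hg) (B + 1) (by linarith) (fun x => by
    have h1 := hgT x
    rw [dist_eq_norm] at h1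
    have h2 : ‖g x‖ ≤ ‖g x - T x‖ + ‖T x‖ := by
      simpa using norm_add_le (g x - T x) (T x)
    have := hb x
    have := min_le_left 1 ‖T x₀ - x₀‖
    linarith)
  have h1 := hgT x
  have h2 : ‖T x₀ - x₀‖ ≤ ‖T x - x‖ := hx₀ hx
  rw [hgx, dist_comm, dist_eq_norm] at h1
  exact absurd (h1.trans_le (min_le_right _ _)) (not_lt.2 h2)

end Brouwer2

/-- Brouwer's fixed point theorem for continuous self-maps of bounded range. -/
theorem brouwer {V : Type*} [NormedAddCommGroup V] [NormedSpace ℝ V] [FiniteDimensional ℝ V]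
    (T : V → V) (hT : Continuous T) (B : ℝ) (hb : ∀ x, ‖T x‖ ≤ B) : ∃ x, T x = x := by
  let e : V ≃L[ℝ] EuclideanSpace ℝ (Fin (Module.finrank ℝ V)) :=
    ContinuousLinearEquiv.ofFinrankEq (by simp)
  obtain ⟨x, hx⟩ := brouwer_inner (fun y => e (T (e.symm y))) (by fun_prop)
    (‖e.toContinuousLinearMap‖ * B) (fun y => (e.toContinuousLinearMap.le_opNorm _).trans
      (mul_le_mul_of_nonneg_left (hb _) (norm_nonneg _)))
  refine ⟨e.symm x, ?_⟩
  have := congrArg e.symm hx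
  simpa using this

end HZ

namespace HZ

/-- Linking: a consequence of Brouwer's theorem. -/
lemma linking {Y : Type*} [NormedAddCommGroup Y] [NormedSpace ℝ Y] [FiniteDimensional ℝ Y]
    (F₁ : Y × ℝ → Y) (F₂ : Y × ℝ → ℝ) (h₁ : Continuous F₁) (h₂ : Continuous F₂) (τ ρ : ℝ)
    (hρ : 0 < ρ)
    (hout : ∀ v : Y × ℝ, (v.2 ≤ 0 ∨ τ ≤ ‖v‖) → F₁ v = v.1 ∧ F₂ v = max v.2 0) :
    ∃ v, F₁ v = 0 ∧ F₂ v = ρ := by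
  let T : Y × ℝ → Y × ℝ := fun v => (v.1 - F₁ v, v.2 - min v.2 0 - F₂ v + ρ)
  have hT : Continuous T := by fun_prop
  have hTout : ∀ v : Y × ℝ, (v.2 ≤ 0 ∨ τ ≤ ‖v‖) → T v = (0, ρ) := by
    intro v hv
    obtain ⟨e1, e2⟩ := hout v hv
    simp only [T, e1, e2, sub_self]
    congr 1
    rcases le_total v.2 0 with h | h
    · simp [h]
    · simp [h]
  obtain ⟨B, hB⟩ := (isCompact_closedBall (0 : Y × ℝ) τ).exists_bound_of_continuousOn hT.continuousOn
  obtain ⟨v, hv⟩ := brouwer T hT (max B ‖((0:Y), ρ)‖) (fun v => by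
    by_cases h : τ ≤ ‖v‖
    · rw [hTout v (Or.inr h)]; exact le_max_right _ _
    · exact (hB v (by simpa using (not_le.1 h).le)).trans (le_max_left _ _))
  have e1 : F₁ v = 0 := by
    have := congrArg Prod.fst hv
    simpa [T] using this
  have e2 : F₂ v = ρ - min v.2 0 := by
    have := congrArg Prod.snd hv
    simp only [T] at this
    linarith
  refine ⟨v, e1, ?_⟩
  rcases le_or_gt v.2 0 with h | h
  · exfalso
    have h3 := (hout v (Or.inl h)).2
    rw [e2, max_eq_right h, min_eq_left h] at h3
    linarith
  · rw [e2, min_eq_right h.le, sub_zero]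

/-- Deformation by discrete gradient descent. -/
lemma deform {X : Type*} [NormedAddCommGroup X] [InnerProductSpace ℝ X]
    {V : Type*} [TopologicalSpace V] (Φ : X → ℝ) (g : X → X) (L : ℝ) (hL : 0 < L)
    (hΦ : Continuous Φ) (hg : Continuous g)
    (hdesc : ∀ x v, Φ (x + v) ≤ Φ x + ⟪g x, v⟫ + L * ‖v‖ ^ 2)
    (a b δ : ℝ) (ha : 0 < a) (hδ : 0 < δ) (hcrit : ∀ x, a ≤ Φ x → Φ x ≤ b → δ ≤ ‖g x‖)
    (h : V → X) (hh : Continuous h) (hb : ∀ v, Φ (h v) ≤ b) :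
    ∃ h' : V → X, Continuous h' ∧ (∀ v, Φ (h v) ≤ 0 → h' v = h v) ∧ ∀ v, Φ (h' v) < a := by
  let χ : X → ℝ := fun x => max 0 (min 1 (Φ x / a))
  have hχ : Continuous χ := by fun_prop
  have hχ0 : ∀ x, 0 ≤ χ x := fun x => le_max_left _ _
  have hχ1 : ∀ x, χ x ≤ 1 := fun x => max_le zero_le_one (min_le_left _ _)
  let η := 1 / (2 * L)
  have hη : 0 < η := by positivity
  let S : X → X := fun x => x + (-(η * χ x)) • g x
  have hS : Continuous S := by fun_prop
  have hdec : ∀ x, Φ (S x) ≤ Φ x - η / 2 * χ x * ‖g x‖ ^ 2 := by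
    intro x
    refine (hdesc x _).trans ?_
    rw [inner_smul_right, real_inner_self_eq_norm_sq, norm_smul, mul_pow, Real.norm_eq_abs, sq_abs]
    have e : L * ((-(η * χ x)) ^ 2 * ‖g x‖ ^ 2) = η / 2 * (χ x * χ x) * ‖g x‖ ^ 2 := by
      simp only [η]; field_simp
    rw [e]
    have : χ x * χ x ≤ χ x := mul_le_of_le_one_left (hχ0 x) (hχ1 x)
    have h3 : η / 2 * (χ x * χ x) * ‖g x‖ ^ 2 ≤ η / 2 * χ x * ‖g x‖ ^ 2 := by gcongr
    linarith
  have hmono : ∀ x, Φ (S x) ≤ Φ x := fun x => (hdec x).trans (by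
    have := hχ0 x
    have : 0 ≤ η / 2 * χ x * ‖g x‖ ^ 2 := by positivity
    linarith)
  have hfix : ∀ x, Φ x ≤ 0 → S x = x := by
    intro x hx
    have : χ x = 0 := by
      simp only [χ]
      exact max_eq_left ((min_le_right _ _).trans (div_nonpos_of_nonpos_of_nonneg hx ha.le))
    simp [S, this]
  have hiter : ∀ m : ℕ, ∀ x, Φ x ≤ b →
      Φ (S^[m] x) < a ∨ Φ (S^[m] x) ≤ b - m * (η / 2 * δ ^ 2) := by
    intro m x hx
    induction m with
    | zero => right; simpa using hx
    | succ m ih =>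
      rw [Function.iterate_succ_apply']
      set y := S^[m] x
      by_cases hya : Φ y < a
      · exact Or.inl ((hmono y).trans_lt hya)
      · right
        have ih' := ih.resolve_left hya
        push Not at hya
        have hyb : Φ y ≤ b := ih'.trans (by
          have : 0 ≤ m * (η / 2 * δ ^ 2) := by positivity
          linarith)
        have h1 := hcrit y hya hyb
        have hc : χ y = 1 := by
          simp only [χ]
          rw [min_eq_left ((one_le_div ha).2 hya)]; simp
        have h2 := hdec y
        rw [hc] at h2
        have h3 : η / 2 * 1 * δ ^ 2 ≤ η / 2 * 1 * ‖g y‖ ^ 2 := by gcongr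
        push_cast
        linarith
  obtain ⟨m, hm⟩ := exists_nat_gt ((b - a) / (η / 2 * δ ^ 2))
  refine ⟨fun v => S^[m] (h v), (hS.iterate m).comp hh, fun v hv => ?_, fun v => ?_⟩
  · have : Function.IsFixedPt S (h v) := hfix _ hv
    exact this.iterate m
  · rcases hiter m (h v) (hb v) with h1 | h1
    · exact h1
    · rw [div_lt_iff₀ (by positivity)] at hm
      linarith

end HZ

namespace HZ
set_option linter.unusedSectionVars false
open MeasureTheory

section Rot
variable {E : Type*} [NormedAddCommGroup E] [InnerProductSpace ℝ E]

/-- Rotation by the angle `θ` in the complex structure `J`. -/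
def rot (J : E ≃ₗᵢ[ℝ] E) (θ : ℝ) (x : E) : E := Real.cos θ • x + Real.sin θ • J x

variable {J : E ≃ₗᵢ[ℝ] E}

lemma rot_zero (x : E) : rot J 0 x = x := by simp [rot]

lemma rot_add (θ : ℝ) (x y : E) : rot J θ (x + y) = rot J θ x + rot J θ y := by
  simp only [rot, map_add, smul_add]; abel

lemma rot_smul (θ r : ℝ) (x : E) : rot J θ (r • x) = r • rot J θ x := by
  simp only [rot, map_smul, smul_add, smul_comm r]

lemma rot_comp (hJ : ∀ x, J (J x) = -x) (a b : ℝ) (x : E) :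
    rot J a (rot J b x) = rot J (a + b) x := by
  simp only [rot, map_add, map_smul, hJ, Real.cos_add, Real.sin_add]
  module

lemma rot_J (θ : ℝ) (x : E) : rot J θ (J x) = J (rot J θ x) := by
  simp only [rot, map_add, map_smul]

lemma inner_J (hJ : ∀ x, J (J x) = -x) (x y : E) : ⟪J x, y⟫ = -⟪x, J y⟫ := by
  rw [← J.inner_map_map x (J y), hJ, inner_neg_right, neg_neg]

lemma inner_J_self (hJ : ∀ x, J (J x) = -x) (x : E) : ⟪J x, x⟫ = 0 := by
  have := inner_J hJ x x
  rw [real_inner_comm (J x) x] at this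
  linarith

lemma inner_rot (hJ : ∀ x, J (J x) = -x) (θ : ℝ) (x y : E) :
    ⟪rot J θ x, y⟫ = ⟪x, rot J (-θ) y⟫ := by
  simp only [rot, inner_add_left, inner_add_right, inner_smul_left, inner_smul_right,
    Real.cos_neg, Real.sin_neg, inner_J hJ]
  simp

lemma norm_rot (hJ : ∀ x, J (J x) = -x) (θ : ℝ) (x : E) : ‖rot J θ x‖ = ‖x‖ := by
  have : ‖rot J θ x‖ ^ 2 = ‖x‖ ^ 2 := by
    rw [← real_inner_self_eq_norm_sq, inner_rot hJ, rot_comp hJ, neg_add_cancel, rot_zero,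
      real_inner_self_eq_norm_sq]
  exact (sq_eq_sq₀ (norm_nonneg _) (norm_nonneg _)).1 this

lemma rot_periodic (k : ℤ) (t : ℝ) (x : E) :
    rot J (2 * Real.pi * k * (t + 1)) x = rot J (2 * Real.pi * k * t) x := by
  have : 2 * Real.pi * k * (t + 1) = 2 * Real.pi * k * t + k * (2 * Real.pi) := by ring
  simp only [rot, this, Real.cos_add_int_mul_two_pi, Real.sin_add_int_mul_two_pi]

lemma continuous_rot : Continuous fun p : ℝ × E => rot J p.1 p.2 := by
  unfold rot
  have := J.continuous
  fun_prop

lemma Continuous.rot {α : Type*} [TopologicalSpace α] {θ : α → ℝ} {f : α → E}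
    (hθ : Continuous θ) (hf : Continuous f) : Continuous fun a => rot J (θ a) (f a) :=
  continuous_rot.comp (hθ.prodMk hf)

lemma hasDerivAt_rot (hJ : ∀ x, J (J x) = -x) (ω t : ℝ) (x : E) :
    HasDerivAt (fun t => rot J (ω * t) x) (ω • J (rot J (ω * t) x)) t := by
  have h1 : HasDerivAt (fun t : ℝ => ω * t) ω t := by
    simpa using (hasDerivAt_id t).const_mul ω
  have h2 := (h1.cos.smul_const x).add (h1.sin.smul_const (J x))
  refine HasDerivAt.congr_deriv (f := fun t => rot J (ω * t) x) h2 ?_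
  simp only [rot, map_add, map_smul, hJ]
  module

/-- product rule for a rotating frame -/
lemma hasDerivAt_rot_apply (hJ : ∀ x, J (J x) = -x) (ω t : ℝ) (y : ℝ → E) (y' : E)
    (hy : HasDerivAt y y' t) :
    HasDerivAt (fun t => rot J (ω * t) (y t)) (ω • J (rot J (ω * t) (y t)) + rot J (ω * t) y') t := by
  have h1 : HasDerivAt (fun t : ℝ => ω * t) ω t := by
    simpa using (hasDerivAt_id t).const_mul ω
  have h3 : HasDerivAt (fun t => J (y t)) (J y') t :=
    (J : E ≃L[ℝ] E).toContinuousLinearMap.hasFDerivAt.comp_hasDerivAt t hy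
  have h2 := (h1.cos.smul hy).add (h1.sin.smul h3)
  refine HasDerivAt.congr_deriv (f := fun t => rot J (ω * t) (y t)) h2 ?_
  simp only [rot, map_add, map_smul, hJ]
  module

lemma integral_cos_int (m : ℤ) (hm : m ≠ 0) : ∫ t in (0:ℝ)..1, Real.cos (2 * Real.pi * m * t) = 0 := by
  have h : (2 * Real.pi * m : ℝ) ≠ 0 := by
    have : (m:ℝ) ≠ 0 := by exact_mod_cast hm
    positivity
  rw [intervalIntegral.integral_comp_mul_left (fun u => Real.cos u) h, integral_cos]
  have : 2 * Real.pi * (m:ℝ) * 1 = 0 + m * (2 * Real.pi) := by ring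
  rw [this, Real.sin_add_int_mul_two_pi]; simp

lemma integral_sin_int (m : ℤ) : ∫ t in (0:ℝ)..1, Real.sin (2 * Real.pi * m * t) = 0 := by
  by_cases hm : m = 0
  · simp [hm]
  have h : (2 * Real.pi * m : ℝ) ≠ 0 := by
    have : (m:ℝ) ≠ 0 := by exact_mod_cast hm
    positivity
  rw [intervalIntegral.integral_comp_mul_left (fun u => Real.sin u) h, integral_sin]
  have : 2 * Real.pi * (m:ℝ) * 1 = 0 + m * (2 * Real.pi) := by ring
  rw [this, Real.cos_add_int_mul_two_pi]; simp

variable [FiniteDimensional ℝ E]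

/-- The `k`-th Fourier coefficient of a loop. -/
def coef (J : E ≃ₗᵢ[ℝ] E) (f : ℝ → E) (k : ℤ) : E :=
  ∫ t in (0:ℝ)..1, rot J (-(2 * Real.pi * k * t)) (f t)

lemma coef_mode (hJ : ∀ x, J (J x) = -x) (k l : ℤ) (x : E) :
    coef J (fun t => rot J (2 * Real.pi * l * t) x) k = if l = k then x else 0 := by
  have e : ∀ t : ℝ, rot J (-(2 * Real.pi * k * t)) (rot J (2 * Real.pi * l * t) x) =
      Real.cos (2 * Real.pi * (l - k : ℤ) * t) • x + Real.sin (2 * Real.pi * (l - k : ℤ) * t) • J x := by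
    intro t
    rw [rot_comp hJ]
    have : -(2 * Real.pi * k * t) + 2 * Real.pi * l * t = 2 * Real.pi * (l - k : ℤ) * t := by
      push_cast; ring
    rw [this, rot]
  unfold coef
  simp_rw [e]
  rw [intervalIntegral.integral_add (by apply Continuous.intervalIntegrable; fun_prop)
    (by apply Continuous.intervalIntegrable; fun_prop),
    intervalIntegral.integral_smul_const, intervalIntegral.integral_smul_const, integral_sin_int]
  by_cases h : l = k
  · simp [h]
  · rw [integral_cos_int _ (sub_ne_zero.2 h)]; simp [h]

lemma coef_add {f g : ℝ → E} (hf : Continuous f) (hg : Continuous g) (k : ℤ) :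
    coef J (fun t => f t + g t) k = coef J f k + coef J g k := by
  unfold coef
  simp_rw [rot_add]
  exact intervalIntegral.integral_add
    ((Continuous.rot (by fun_prop) hf).intervalIntegrable _ _)
    ((Continuous.rot (by fun_prop) hg).intervalIntegrable _ _)

lemma coef_smul (r : ℝ) (f : ℝ → E) (k : ℤ) :
    coef J (fun t => r • f t) k = r • coef J f k := by
  unfold coef
  simp_rw [rot_smul]
  exact intervalIntegral.integral_smul _ _

lemma inner_coef (hJ : ∀ x, J (J x) = -x) {f : ℝ → E} (hf : Continuous f) (k : ℤ) (x : E) :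
    ⟪coef J f k, x⟫ = ∫ t in (0:ℝ)..1, ⟪f t, rot J (2 * Real.pi * k * t) x⟫ := by
  rw [real_inner_comm, coef, ← innerSL_apply_apply ℝ, ← ContinuousLinearMap.intervalIntegral_comp_comm _
    ((Continuous.rot (by fun_prop) hf).intervalIntegrable _ _)]
  refine intervalIntegral.integral_congr fun t _ => ?_
  simp only [innerSL_apply_apply]
  rw [real_inner_comm, inner_rot hJ, neg_neg]

lemma coef_J (hJ : ∀ x, J (J x) = -x) {f : ℝ → E} (hf : Continuous f) (k : ℤ) :
    coef J (fun t => J (f t)) k = J (coef J f k) := by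
  unfold coef
  have := ContinuousLinearMap.intervalIntegral_comp_comm (J : E ≃L[ℝ] E).toContinuousLinearMap
    (((Continuous.rot (J := J) (θ := fun t : ℝ => -(2 * Real.pi * k * t)) (by fun_prop) hf)).intervalIntegrable (μ := volume) 0 1)
  simp_rw [rot_J]
  exact this

/-- trigonometric polynomials -/
abbrev XS (E : Type*) (S : Finset ℤ) := PiLp 2 (fun _ : S => E)

def ev (J : E ≃ₗᵢ[ℝ] E) {S : Finset ℤ} (c : XS E S) (t : ℝ) : E :=
  ∑ k : S, rot J (2 * Real.pi * (k:ℤ) * t) (c k)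

variable {S : Finset ℤ}

lemma ev_add (c d : XS E S) (t : ℝ) : ev J (c + d) t = ev J c t + ev J d t := by
  simp only [ev, PiLp.add_apply, rot_add, Finset.sum_add_distrib]

lemma continuous_ev2 : Continuous fun p : XS E S × ℝ => ev J p.1 p.2 := by
  unfold ev
  refine continuous_finsetSum _ fun k _ => ?_
  exact Continuous.rot (by fun_prop) (by fun_prop)

lemma continuous_ev (c : XS E S) : Continuous (ev J c) := by
  unfold ev
  refine continuous_finsetSum _ fun k _ => ?_
  exact Continuous.rot (by fun_prop) continuous_const

lemma ev_inner (hJ : ∀ x, J (J x) = -x) {f : ℝ → E} (hf : Continuous f) (c : XS E S) :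
    ∫ t in (0:ℝ)..1, ⟪f t, ev J c t⟫ = ∑ k : S, ⟪coef J f k, c k⟫ := by
  simp_rw [inner_coef hJ hf]
  rw [← intervalIntegral.integral_finsetSum]
  · simp only [ev, inner_sum]
  · intro k _
    apply Continuous.intervalIntegrable
    exact hf.inner (Continuous.rot (by fun_prop) continuous_const)

lemma coef_ev (hJ : ∀ x, J (J x) = -x) (c : XS E S) (k : S) : coef J (ev J c) k = c k := by
  have e : coef J (ev J c) k = ∑ l : S, coef J (fun t => rot J (2 * Real.pi * (l:ℤ) * t) (c l)) k := by
    unfold coef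
    rw [← intervalIntegral.integral_finsetSum]
    · refine intervalIntegral.integral_congr fun t _ => ?_
      simp only [ev]
      exact map_sum (AddMonoidHom.mk' (rot J (-(2 * Real.pi * (k:ℤ) * t))) (rot_add _)) _ _
    · intro l _
      exact (Continuous.rot (by fun_prop) (Continuous.rot (by fun_prop) continuous_const)).intervalIntegrable _ _
  rw [e]
  simp_rw [coef_mode hJ]
  rw [Finset.sum_eq_single k]
  · simp
  · intro b _ hb
    rw [if_neg]
    exact fun h => hb (Subtype.ext h)
  · simp

lemma integral_ev_sq (hJ : ∀ x, J (J x) = -x) (c : XS E S) :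
    ∫ t in (0:ℝ)..1, ‖ev J c t‖ ^ 2 = ‖c‖ ^ 2 := by
  simp_rw [← real_inner_self_eq_norm_sq (ev J c _)]
  rw [ev_inner hJ (continuous_ev c), PiLp.norm_sq_eq_of_L2]
  refine Finset.sum_congr rfl fun k _ => ?_
  rw [coef_ev hJ, real_inner_self_eq_norm_sq]

/-- Bessel's inequality -/
lemma bessel (hJ : ∀ x, J (J x) = -x) {f : ℝ → E} (hf : Continuous f) (B : ℝ)
    (hB : ∀ t, ‖f t‖ ≤ B) : ∑ k : S, ‖coef J f k‖ ^ 2 ≤ B ^ 2 := by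
  let c : XS E S := WithLp.toLp 2 fun k : S => coef J f k
  have h1 := ev_inner hJ hf c
  have hc : ‖c‖ ^ 2 = ∑ k : S, ‖coef J f k‖ ^ 2 := PiLp.norm_sq_eq_of_L2 _ _
  have h2 : ∑ k : S, ⟪coef J f k, c k⟫ = ‖c‖ ^ 2 := by
    rw [hc]; refine Finset.sum_congr rfl fun k _ => ?_
    simp [c]
  have h3 : ∫ t in (0:ℝ)..1, ⟪f t, ev J c t⟫ ≤
      ∫ t in (0:ℝ)..1, (B ^ 2 / 2 + ‖ev J c t‖ ^ 2 / 2) := by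
    have hce := continuous_ev (J := J) c
    refine intervalIntegral.integral_mono_on zero_le_one ?_ ?_ fun t _ => ?_
    · exact (hf.inner hce).intervalIntegrable _ _
    · apply Continuous.intervalIntegrable; fun_prop
    · have i1 := real_inner_le_norm (f t) (ev J c t)
      have i2 := hB t
      nlinarith [sq_nonneg (‖f t‖ - ‖ev J c t‖), norm_nonneg (f t)]
  rw [intervalIntegral.integral_add (by simp) (by
    have hce := continuous_ev (J := J) c
    apply Continuous.intervalIntegrable; fun_prop), intervalIntegral.integral_const,
    intervalIntegral.integral_div, integral_ev_sq hJ] at h3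
  simp only [sub_zero, one_smul] at h3
  rw [← hc]
  linarith

end Rot
end HZ

namespace HZ
open MeasureTheory
set_option linter.unusedSectionVars false

section Galerkin
variable {E : Type*} [NormedAddCommGroup E] [InnerProductSpace ℝ E] [FiniteDimensional ℝ E]
variable {J : E ≃ₗᵢ[ℝ] E}

/-- Asymptotically quadratic, nonresonant Hamiltonians. -/
structure Good (K : E → ℝ) (dK : E → E) (A : ℝ) : Prop where
  contK : Continuous K
  contdK : Continuous dK
  desc : ∃ L > 0, ∀ z w, K z + ⟪dK z, w⟫ - L * ‖w‖ ^ 2 ≤ K (z + w)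
  bdd : ∃ B, ∀ z, ‖dK z - (2 * A) • z‖ ≤ B
  gap : ∃ c > 0, ∀ k : ℤ, c * (1 + |(k:ℝ)|) ≤ |2 * Real.pi * k - 2 * A|

/-- symmetric mode set -/
abbrev SN (N : ℕ) : Finset ℤ := Finset.Icc (-(N:ℤ)) N

variable {S : Finset ℤ}

def quad (c : XS E S) : ℝ := ∑ k : S, ((k:ℤ):ℝ) * ‖c k‖ ^ 2

/-- The Galerkin action functional. -/
def Phi (J : E ≃ₗᵢ[ℝ] E) (K : E → ℝ) (c : XS E S) : ℝ :=
  Real.pi * quad c - ∫ t in (0:ℝ)..1, K (ev J c t)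

/-- The gradient of the Galerkin action functional. -/
def gPhi (J : E ≃ₗᵢ[ℝ] E) (dK : E → E) (c : XS E S) : XS E S :=
  WithLp.toLp 2 fun k : S => (2 * Real.pi * ((k:ℤ):ℝ)) • c k - coef J (fun t => dK (ev J c t)) k

lemma gPhi_apply (dK : E → E) (c : XS E S) (k : S) :
    gPhi J dK c k = (2 * Real.pi * ((k:ℤ):ℝ)) • c k - coef J (fun t => dK (ev J c t)) k := rfl

lemma continuous_Phi {K : E → ℝ} (hK : Continuous K) :
    Continuous (Phi (S := S) J K) := by
  unfold Phi quad
  refine Continuous.sub (by fun_prop) ?_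
  exact intervalIntegral.continuous_parametric_intervalIntegral_of_continuous'
    (f := fun (c : XS E S) t => K (ev J c t)) (hK.comp continuous_ev2) 0 1

lemma continuous_gPhi {dK : E → E} (hK : Continuous dK) :
    Continuous (gPhi (S := S) J dK) := by
  unfold gPhi
  refine (PiLp.continuous_toLp 2 _).comp (continuous_pi fun k => ?_)
  refine Continuous.sub (by fun_prop) ?_
  unfold coef
  refine intervalIntegral.continuous_parametric_intervalIntegral_of_continuous'
    (f := fun (c : XS E S) t => rot J (-(2 * Real.pi * ((k:ℤ):ℝ) * t)) (dK (ev J c t))) ?_ 0 1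
  exact Continuous.rot (by fun_prop) (hK.comp continuous_ev2)

lemma inner_gPhi (hJ : ∀ x, J (J x) = -x) {dK : E → E} (hK : Continuous dK) (c v : XS E S) :
    ⟪gPhi J dK c, v⟫ = 2 * Real.pi * (∑ k : S, ((k:ℤ):ℝ) * ⟪c k, v k⟫) -
      ∫ t in (0:ℝ)..1, ⟪dK (ev J c t), ev J v t⟫ := by
  have hc : Continuous fun t => dK (ev J c t) := hK.comp (continuous_ev c)
  rw [ev_inner hJ hc, PiLp.inner_apply, Finset.mul_sum,
    ← Finset.sum_sub_distrib]
  refine Finset.sum_congr rfl fun k _ => ?_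
  rw [gPhi_apply, inner_sub_left, real_inner_smul_left, mul_assoc]

lemma quad_add (c v : XS E S) :
    quad (c + v) = quad c + 2 * (∑ k : S, ((k:ℤ):ℝ) * ⟪c k, v k⟫) + quad v := by
  unfold quad
  rw [Finset.mul_sum, ← Finset.sum_add_distrib, ← Finset.sum_add_distrib]
  refine Finset.sum_congr rfl fun k _ => ?_
  rw [PiLp.add_apply, norm_add_sq_real]; ring

lemma quad_le {N : ℕ} (c : XS E (SN N)) : quad c ≤ N * ‖c‖ ^ 2 := by
  rw [PiLp.norm_sq_eq_of_L2, Finset.mul_sum]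
  unfold quad
  refine Finset.sum_le_sum fun k _ => ?_
  have : ((k:ℤ):ℝ) ≤ N := by exact_mod_cast (Finset.mem_Icc.1 k.2).2
  gcongr

lemma Phi_desc (hJ : ∀ x, J (J x) = -x) {K : E → ℝ} {dK : E → E} {A : ℝ} (hK : Good K dK A) (N : ℕ) :
    ∃ L > 0, ∀ c v : XS E (SN N),
      Phi J K (c + v) ≤ Phi J K c + ⟪gPhi J dK c, v⟫ + L * ‖v‖ ^ 2 := by
  obtain ⟨L, hL, hd⟩ := hK.desc
  have cK := hK.contK
  have cdK := hK.contdK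
  refine ⟨Real.pi * N + L, by positivity, fun c v => ?_⟩
  rw [inner_gPhi hJ hK.contdK]
  unfold Phi
  rw [quad_add]
  have h1 := quad_le v
  have hc := continuous_ev (J := J) c
  have hv := continuous_ev (J := J) v
  have h2 : (∫ t in (0:ℝ)..1, (K (ev J c t) + ⟪dK (ev J c t), ev J v t⟫ - L * ‖ev J v t‖ ^ 2)) ≤
      ∫ t in (0:ℝ)..1, K (ev J (c + v) t) := by
    refine intervalIntegral.integral_mono_on zero_le_one ?_ ?_ fun t _ => ?_
    · apply Continuous.intervalIntegrable; fun_prop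
    · exact (hK.contK.comp (continuous_ev _)).intervalIntegrable _ _
    · rw [ev_add]; exact hd _ _
  rw [intervalIntegral.integral_sub, intervalIntegral.integral_add,
    intervalIntegral.integral_const_mul, integral_ev_sq hJ] at h2
  · nlinarith [Real.pi_pos]
  all_goals (apply Continuous.intervalIntegrable; fun_prop)

/-- action identity at approximate critical points -/
lemma Phi_eq (hJ : ∀ x, J (J x) = -x) {K : E → ℝ} {dK : E → E} (hdK : Continuous dK) (c : XS E S) :
    Phi J K c = (1/2) * (∫ t in (0:ℝ)..1, ⟪dK (ev J c t), ev J c t⟫) + (1/2) * ⟪gPhi J dK c, c⟫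
      - ∫ t in (0:ℝ)..1, K (ev J c t) := by
  rw [inner_gPhi hJ hdK]
  unfold Phi quad
  simp_rw [real_inner_self_eq_norm_sq]
  ring

/-- A priori bounds at approximate critical points. -/
lemma apriori (hJ : ∀ x, J (J x) = -x) {K : E → ℝ} {dK : E → E} {A : ℝ} (hK : Good K dK A) :
    ∃ M > 0, ∀ (S : Finset ℤ) (c : XS E S), ‖gPhi J dK c‖ ≤ 1 →
      ∑ k : S, (1 + |((k:ℤ):ℝ)|) ^ 2 * ‖c k‖ ^ 2 ≤ M := by
  obtain ⟨B, hB⟩ := hK.bdd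
  obtain ⟨c₀, hc₀, hgap⟩ := hK.gap
  refine ⟨(2 * B ^ 2 + 2) / c₀ ^ 2, by positivity, fun S c hg => ?_⟩
  have hce := continuous_ev (J := J) c
  have hdKc : Continuous fun t => dK (ev J c t) := hK.contdK.comp hce
  set f : ℝ → E := fun t => dK (ev J c t) + (-(2 * A)) • ev J c t with hf
  have hfc : Continuous f := hdKc.add (hce.const_smul _)
  have hfB : ∀ t, ‖f t‖ ≤ B := by
    intro t
    have := hB (ev J c t)
    rwa [sub_eq_add_neg, ← neg_smul] at this
  have hbes := bessel (S := S) hJ hfc B hfB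
  have hco : ∀ k : S, coef J f k = coef J (fun t => dK (ev J c t)) k + (-(2*A)) • c k := by
    intro k
    rw [hf, coef_add hdKc (by fun_prop), coef_smul, coef_ev hJ]
  have hg2 : ∑ k : S, ‖gPhi J dK c k‖ ^ 2 ≤ 1 := by
    rw [← PiLp.norm_sq_eq_of_L2]
    nlinarith [norm_nonneg (gPhi J dK c)]
  rw [le_div_iff₀ (by positivity), Finset.sum_mul]
  calc ∑ k : S, (1 + |((k:ℤ):ℝ)|) ^ 2 * ‖c k‖ ^ 2 * c₀ ^ 2
      ≤ ∑ k : S, (2 * ‖coef J f k‖ ^ 2 + 2 * ‖gPhi J dK c k‖ ^ 2) := by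
        refine Finset.sum_le_sum fun k _ => ?_
        have e : (2 * Real.pi * ((k:ℤ):ℝ) - 2 * A) • c k = coef J f k + gPhi J dK c k := by
          rw [hco, gPhi_apply]; module
        have n1 : |2 * Real.pi * ((k:ℤ):ℝ) - 2 * A| * ‖c k‖ ≤ ‖coef J f k‖ + ‖gPhi J dK c k‖ := by
          have := norm_add_le (coef J f k) (gPhi J dK c k)
          rwa [← e, norm_smul, Real.norm_eq_abs] at this
        have n2 : c₀ * (1 + |((k:ℤ):ℝ)|) * ‖c k‖ ≤ ‖coef J f k‖ + ‖gPhi J dK c k‖ :=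
          le_trans (mul_le_mul_of_nonneg_right (hgap k) (norm_nonneg _)) n1
        have n3 : (c₀ * (1 + |((k:ℤ):ℝ)|) * ‖c k‖) ^ 2 ≤ (‖coef J f k‖ + ‖gPhi J dK c k‖) ^ 2 :=
          pow_le_pow_left₀ (by positivity) n2 2
        nlinarith [sq_nonneg (‖coef J f k‖ - ‖gPhi J dK c k‖)]
    _ = 2 * ∑ k : S, ‖coef J f k‖ ^ 2 + 2 * ∑ k : S, ‖gPhi J dK c k‖ ^ 2 := by
        rw [Finset.sum_add_distrib, Finset.mul_sum, Finset.mul_sum]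
    _ ≤ 2 * B ^ 2 + 2 := by linarith

end Galerkin
end HZ

namespace HZ
open MeasureTheory
set_option linter.unusedSectionVars false

/-- uniqueness of scalar Fourier coefficients -/
lemma fourier_unique (φ : ℝ → ℝ) (hφ : Continuous φ) (hper : ∀ t, φ (t + 1) = φ t)
    (hc : ∀ k : ℤ, ∫ t in (0:ℝ)..1, Real.cos (2 * Real.pi * k * t) * φ t = 0)
    (hs : ∀ k : ℤ, ∫ t in (0:ℝ)..1, Real.sin (2 * Real.pi * k * t) * φ t = 0) (t : ℝ) : φ t = 0 := by
  have hp : Function.Periodic (fun t => (φ t : ℂ)) 1 := fun t => by simp [hper]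
  let F : C(UnitAddCircle, ℂ) := ⟨hp.lift, by
    refine continuous_coinduced_dom.2 ?_
    exact (Complex.continuous_ofReal.comp hφ)⟩
  have hF : ∀ t : ℝ, F (t : UnitAddCircle) = (φ t : ℂ) := fun t => hp.lift_coe t
  have h0 : ∀ k : ℤ, fourierCoeff F k = 0 := by
    intro k
    rw [fourierCoeff_eq_intervalIntegral F k 0]
    have e : ∀ t : ℝ, fourier (-k) (t : UnitAddCircle) • F (t : UnitAddCircle) =
        ((Real.cos (2 * Real.pi * k * t) * φ t : ℝ) : ℂ) -
          Complex.I * ((Real.sin (2 * Real.pi * k * t) * φ t : ℝ) : ℂ) := by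
      intro t
      rw [hF, fourier_coe_apply]
      have : (2 * Real.pi * Complex.I * ((-k : ℤ) : ℂ) * t / ((1:ℝ):ℂ) : ℂ) =
        ((-(2 * Real.pi * k * t) : ℝ) : ℂ) * Complex.I := by push_cast; ring
      rw [this, Complex.exp_mul_I, ← Complex.ofReal_cos, ← Complex.ofReal_sin, Real.cos_neg,
        Real.sin_neg]
      simp only [smul_eq_mul]
      push_cast
      ring
    simp_rw [e]
    rw [zero_add, intervalIntegral.integral_sub, intervalIntegral.integral_const_mul,
      intervalIntegral.integral_ofReal, intervalIntegral.integral_ofReal, hc, hs]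
    · simp
    all_goals (apply Continuous.intervalIntegrable; fun_prop)
  have hsum : Summable (fourierCoeff F) := by
    rw [show fourierCoeff F = 0 from funext h0]; exact summable_zero
  have := has_pointwise_sum_fourier_series_of_summable hsum (t : UnitAddCircle)
  simp only [h0, zero_smul] at this
  have h2 := this.unique hasSum_zero
  rw [hF] at h2
  exact_mod_cast h2

section FT
variable {E : Type*} [NormedAddCommGroup E] [InnerProductSpace ℝ E] [FiniteDimensional ℝ E]
variable {J : E ≃ₗᵢ[ℝ] E}

lemma coef_unique (hJ : ∀ x, J (J x) = -x) (h : ℝ → E) (hh : Continuous h)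
    (hper : ∀ t, h (t + 1) = h t) (hc : ∀ k, coef J h k = 0) (t : ℝ) : h t = 0 := by
  have key : ∀ (v : E) (k : ℤ), (∫ t in (0:ℝ)..1, Real.cos (2 * Real.pi * k * t) * ⟪h t, v⟫) +
      ∫ t in (0:ℝ)..1, Real.sin (2 * Real.pi * k * t) * ⟪h t, J v⟫ = 0 := by
    intro v k
    have := inner_coef hJ hh k v
    rw [hc, inner_zero_left] at this
    have c1 : Continuous fun t : ℝ => Real.cos (2 * Real.pi * k * t) * ⟪h t, v⟫ := by fun_prop
    have c2 : Continuous fun t : ℝ => Real.sin (2 * Real.pi * k * t) * ⟪h t, J v⟫ := by fun_prop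
    rw [← intervalIntegral.integral_add (c1.intervalIntegrable _ _) (c2.intervalIntegrable _ _)]
    refine Eq.trans ?_ this.symm
    refine intervalIntegral.integral_congr fun t _ => ?_
    simp only [rot, inner_add_right, real_inner_smul_right]
  have kc : ∀ (v : E) (k : ℤ), ∫ t in (0:ℝ)..1, Real.cos (2 * Real.pi * k * t) * ⟪h t, v⟫ = 0 := by
    intro v k
    have h1 := key v k
    have h2 := key v (-k)
    have e1 : ∀ t : ℝ, 2 * Real.pi * ((-k : ℤ):ℝ) * t = -(2 * Real.pi * k * t) := by
      intro t; push_cast; ring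
    simp only [e1, Real.cos_neg, Real.sin_neg, neg_mul, intervalIntegral.integral_neg] at h2
    linarith
  have ks : ∀ (v : E) (k : ℤ), ∫ t in (0:ℝ)..1, Real.sin (2 * Real.pi * k * t) * ⟪h t, v⟫ = 0 := by
    intro v k
    have h1 := key (-(J v)) k
    rw [kc] at h1
    simpa [hJ] using h1
  have := fourier_unique (fun s => ⟪h s, h t⟫) (by fun_prop) (fun s => by simp [hper])
    (kc (h t)) (ks (h t)) t
  exact inner_self_eq_zero.1 this

lemma ode_of_coef (hJ : ∀ x, J (J x) = -x) (x f : ℝ → E) (hx : Continuous x) (hf : Continuous f)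
    (px : ∀ t, x (t + 1) = x t) (pf : ∀ t, f (t + 1) = f t)
    (hc : ∀ k : ℤ, coef J f k = (2 * Real.pi * k) • coef J x k) (t : ℝ) :
    HasDerivAt x (J (f t)) t := by
  have cJ := J.continuous
  have hJf : Continuous fun t => J (f t) := cJ.comp hf
  let y : ℝ → E := fun t => ∫ s in (0:ℝ)..t, J (f s)
  have hy : ∀ t, HasDerivAt y (J (f t)) t := fun t =>
    intervalIntegral.integral_hasDerivAt_right (hJf.intervalIntegrable _ _)
      (hJf.stronglyMeasurableAtFilter _ _) hJf.continuousAt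
  have hyc : Continuous y := continuous_iff_continuousAt.2 fun t => (hy t).continuousAt
  have hJ0 : ∫ s in (0:ℝ)..1, J (f s) = 0 := by
    have h1 := coef_J hJ hf 0
    rw [hc] at h1
    simp only [coef] at h1
    simpa [rot_zero] using h1
  have y1 : ∀ t, y (t + 1) = y t := by
    intro t
    have hp : Function.Periodic (fun t => J (f t)) 1 := fun t => by simp [pf]
    have e := hp.intervalIntegral_add_eq t 0
    rw [zero_add, hJ0] at e
    have := intervalIntegral.integral_add_adjacent_intervals
      (hJf.intervalIntegrable (μ := volume) 0 t) (hJf.intervalIntegrable (μ := volume) t (t+1))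
    simp only [y]
    rw [← this, e, add_zero]
  have y0 : y 0 = 0 := by simp [y]
  have cy : ∀ k : ℤ, coef J f k = (2 * Real.pi * k) • coef J y k := by
    intro k
    have hd : ∀ t ∈ uIcc (0:ℝ) 1, HasDerivAt (fun t => rot J (-(2 * Real.pi * k) * t) (y t))
      ((-(2 * Real.pi * k)) • J (rot J (-(2 * Real.pi * k) * t) (y t)) +
        rot J (-(2 * Real.pi * k) * t) (J (f t))) t := fun t _ => hasDerivAt_rot_apply hJ _ t y _ (hy t)
    have c1 : Continuous fun t => J (rot J (-(2 * Real.pi * k) * t) (y t)) :=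
      cJ.comp (Continuous.rot (by fun_prop) hyc)
    have c1' : Continuous fun t => (-(2 * Real.pi * k)) • J (rot J (-(2 * Real.pi * k) * t) (y t)) :=
      c1.const_smul _
    have c2 : Continuous fun t => rot J (-(2 * Real.pi * k) * t) (J (f t)) :=
      Continuous.rot (by fun_prop) hJf
    have h1 := intervalIntegral.integral_eq_sub_of_hasDerivAt hd
      ((c1'.add c2).intervalIntegrable _ _)
    have y11 : y 1 = 0 := by have := y1 0; rwa [zero_add, y0] at this
    have rz : ∀ θ, rot J θ (0:E) = 0 := by intro θ; simp [rot]
    rw [y11, y0, rz, rz, sub_zero, intervalIntegral.integral_add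
      (c1'.intervalIntegrable _ _) (c2.intervalIntegrable _ _),
      intervalIntegral.integral_smul] at h1
    have h2 := coef_J hJ hf k
    have h3 := coef_J hJ hyc k
    simp only [coef] at h2 h3
    simp only [neg_mul] at h1
    simp_rw [rot_J] at h1 h2 h3
    rw [h2, h3] at h1
    have h4 : J (coef J f k) = J ((2 * Real.pi * k) • coef J y k) := by
      rw [map_smul]
      simp only [coef]
      rw [neg_smul, neg_add_eq_zero] at h1
      exact h1.symm
    exact J.injective h4
  let v := coef J (fun t => x t + (-1 : ℝ) • y t) 0
  have hz : ∀ t, x t + (-1 : ℝ) • y t + (-1 : ℝ) • v = 0 := by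
    refine coef_unique hJ _ (by fun_prop) (fun t => by rw [px, y1]) fun k => ?_
    rw [coef_add (by fun_prop) (by fun_prop), coef_smul]
    have ev : coef J (fun _ => v) k = if (0:ℤ) = k then v else 0 := by
      have := coef_mode hJ k 0 v
      simpa [rot_zero] using this
    rw [ev]
    by_cases hk : k = 0
    · subst hk; simp [v]
    · rw [if_neg (Ne.symm hk), coef_add hx (by fun_prop), coef_smul]
      have h1 := (hc k).symm.trans (cy k)
      have hk' : (2 * Real.pi * k : ℝ) ≠ 0 := by
        have : (k:ℝ) ≠ 0 := by exact_mod_cast hk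
        positivity
      rw [smul_right_injective E hk' h1]
      module
  have : x = fun t => y t + v := by
    funext t
    have := hz t
    have e : x t - (y t + v) = 0 := by rw [← this]; module
    exact sub_eq_zero.1 e
  rw [this]
  exact (hy t).add_const v

end FT
end HZ

namespace HZ
open MeasureTheory Filter
set_option linter.unusedSectionVars false

lemma summable_wt : Summable fun k : ℤ => 1 / (1 + |(k:ℝ)|) ^ 2 := by
  have h := (Real.summable_one_div_int_add_rpow (1/2) 2).2 (by norm_num)
  refine Summable.of_nonneg_of_le (fun k => by positivity) (fun k => ?_) h
  have h0 : (k:ℝ) + 1/2 ≠ 0 := by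
    intro h
    have : (2 * k + 1 : ℝ) = 0 := by linarith
    have : 2 * k + 1 = 0 := by exact_mod_cast this
    omega
  have h1 : |(k:ℝ) + 1/2| ≤ 1 + |(k:ℝ)| := by
    refine (abs_add_le _ _).trans ?_
    rw [abs_of_pos (by norm_num : (0:ℝ) < 1/2)]; linarith
  rw [Real.rpow_two]
  have : 0 < |(k:ℝ) + 1/2| := abs_pos.2 h0
  gcongr

section LT
variable {E : Type*} [NormedAddCommGroup E] [InnerProductSpace ℝ E] [FiniteDimensional ℝ E]
variable {J : E ≃ₗᵢ[ℝ] E}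

/-- extension of coefficients by zero -/
def ext0 {S : Finset ℤ} (c : XS E S) (k : ℤ) : E := if h : k ∈ S then c ⟨k, h⟩ else 0

lemma ext0_mem {S : Finset ℤ} (c : XS E S) (k : S) : ext0 c k = c k := by
  simp [ext0]

lemma ext0_not_mem {S : Finset ℤ} (c : XS E S) {k : ℤ} (h : k ∉ S) : ext0 c k = 0 := by
  simp [ext0, h]

/-- the loop with given Fourier coefficients -/
def ser (J : E ≃ₗᵢ[ℝ] E) (d : ℤ → E) (t : ℝ) : E := ∑' k : ℤ, rot J (2 * Real.pi * k * t) (d k)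

lemma rot_zero' (θ : ℝ) : rot J θ (0:E) = 0 := by simp [rot]

lemma ser_ext0 {S : Finset ℤ} (c : XS E S) (t : ℝ) : ser J (ext0 c) t = ev J c t := by
  unfold ser ev
  rw [tsum_eq_sum (s := S)]
  · rw [← Finset.sum_coe_sort S]
    exact Finset.sum_congr rfl fun k _ => by rw [ext0_mem]
  · intro k hk
    rw [ext0_not_mem c hk, rot_zero']

/-- weighted square-summability -/
def WS (M : ℝ) (d : ℤ → E) : Prop := ∀ s : Finset ℤ, ∑ k ∈ s, (1 + |(k:ℝ)|) ^ 2 * ‖d k‖ ^ 2 ≤ M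

lemma WS_ext0 {S : Finset ℤ} (c : XS E S) (M : ℝ)
    (h : ∑ k : S, (1 + |((k:ℤ):ℝ)|) ^ 2 * ‖c k‖ ^ 2 ≤ M) : WS M (ext0 c) := by
  intro s
  refine le_trans ?_ h
  have e : ∑ k : S, (1 + |((k:ℤ):ℝ)|) ^ 2 * ‖c k‖ ^ 2 =
      ∑ k ∈ S, (1 + |(k:ℝ)|) ^ 2 * ‖ext0 c k‖ ^ 2 := by
    rw [← Finset.sum_coe_sort S]
    exact Finset.sum_congr rfl fun k _ => by rw [ext0_mem]
  rw [e]
  calc _ = ∑ k ∈ s ∩ S, (1 + |(k:ℝ)|) ^ 2 * ‖ext0 c k‖ ^ 2 := by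
        symm
        refine Finset.sum_subset Finset.inter_subset_left fun k hk hk' => ?_
        have : k ∉ S := fun h => hk' (Finset.mem_inter.2 ⟨hk, h⟩)
        rw [ext0_not_mem c this]; simp
    _ ≤ _ := Finset.sum_le_sum_of_subset_of_nonneg Finset.inter_subset_right
        fun k _ _ => by positivity

lemma WS.summable_sq {M : ℝ} {d : ℤ → E} (h : WS M d) :
    Summable fun k : ℤ => (1 + |(k:ℝ)|) ^ 2 * ‖d k‖ ^ 2 :=
  summable_of_sum_le (fun k => by positivity) h

lemma WS.sub {M : ℝ} {d d' : ℤ → E} (h : WS M d) (h' : WS M d') : WS (4 * M) (fun k => d k - d' k) := by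
  intro s
  have h1 := h s
  have h2 := h' s
  calc ∑ k ∈ s, (1 + |(k:ℝ)|) ^ 2 * ‖d k - d' k‖ ^ 2
      ≤ ∑ k ∈ s, (2 * ((1 + |(k:ℝ)|) ^ 2 * ‖d k‖ ^ 2) + 2 * ((1 + |(k:ℝ)|) ^ 2 * ‖d' k‖ ^ 2)) := by
        refine Finset.sum_le_sum fun k _ => ?_
        have : ‖d k - d' k‖ ^ 2 ≤ 2 * ‖d k‖ ^ 2 + 2 * ‖d' k‖ ^ 2 := by
          have h3 := norm_sub_le (d k) (d' k)
          nlinarith [sq_nonneg (‖d k‖ - ‖d' k‖), norm_nonneg (d k - d' k)]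
        have h4 : 0 ≤ (1 + |(k:ℝ)|) ^ 2 := by positivity
        nlinarith
    _ = 2 * ∑ k ∈ s, (1 + |(k:ℝ)|) ^ 2 * ‖d k‖ ^ 2 + 2 * ∑ k ∈ s, (1 + |(k:ℝ)|) ^ 2 * ‖d' k‖ ^ 2 := by
        rw [Finset.sum_add_distrib, Finset.mul_sum, Finset.mul_sum]
    _ ≤ 4 * M := by linarith

lemma WS.norm_le {M : ℝ} {d : ℤ → E} (h : WS M d) (k : ℤ) : ‖d k‖ ≤ M + 1 := by
  have h1 := h {k}
  rw [Finset.sum_singleton] at h1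
  have h2 : 1 ≤ (1 + |(k:ℝ)|) ^ 2 := by nlinarith [abs_nonneg (k:ℝ)]
  nlinarith [sq_nonneg (‖d k‖ - 1), sq_nonneg ‖d k‖]

lemma WS.summable {M : ℝ} {d : ℤ → E} (h : WS M d) : Summable fun k => ‖d k‖ := by
  refine Summable.of_nonneg_of_le (fun k => norm_nonneg _) (fun k => ?_) (h.summable_sq.add summable_wt)
  have hw : 0 < (1 + |(k:ℝ)|) ^ 2 := by positivity
  have : (1 + |(k:ℝ)|) ^ 2 * (1 / (1 + |(k:ℝ)|) ^ 2) = 1 := by field_simp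
  have h0 : 0 < 1 / (1 + |(k:ℝ)|) ^ 2 := by positivity
  set w := (1 + |(k:ℝ)|) ^ 2
  set u := 1 / w
  by_contra hcon
  push Not at hcon
  nlinarith [sq_nonneg (‖d k‖ - u), norm_nonneg (d k), mul_pos hw h0, sq_nonneg (w * ‖d k‖ - 1), sq_nonneg (‖d k‖ * w - w * u)]

lemma WS.tsum_norm_le {M : ℝ} {d : ℤ → E} (h : WS M d) (l : ℝ) (hl : 0 < l) :
    ∑' k, ‖d k‖ ≤ l * M + ∑' k : ℤ, min ‖d k‖ (1 / l * (1 / (1 + |(k:ℝ)|) ^ 2)) := by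
  have s2 : Summable fun k : ℤ => min ‖d k‖ (1 / l * (1 / (1 + |(k:ℝ)|) ^ 2)) :=
    Summable.of_nonneg_of_le (fun k => by positivity) (fun k => min_le_left _ _) h.summable
  calc ∑' k, ‖d k‖ ≤ ∑' k : ℤ, (l * ((1 + |(k:ℝ)|) ^ 2 * ‖d k‖ ^ 2) +
        min ‖d k‖ (1 / l * (1 / (1 + |(k:ℝ)|) ^ 2))) := by
        refine h.summable.tsum_le_tsum (fun k => ?_) ((h.summable_sq.mul_left l).add s2)
        rcases le_total ‖d k‖ (1 / l * (1 / (1 + |(k:ℝ)|) ^ 2)) with h1 | h1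
        · rw [min_eq_left h1]
          have : 0 ≤ l * ((1 + |(k:ℝ)|) ^ 2 * ‖d k‖ ^ 2) := by positivity
          linarith
        · rw [min_eq_right h1]
          have h2 : 0 < (1 + |(k:ℝ)|) ^ 2 := by positivity
          have h3 : 1 ≤ l * (1 + |(k:ℝ)|) ^ 2 * ‖d k‖ := by
            have := mul_le_mul_of_nonneg_left h1 (by positivity : 0 ≤ l * (1 + |(k:ℝ)|) ^ 2)
            have e : l * (1 + |(k:ℝ)|) ^ 2 * (1 / l * (1 / (1 + |(k:ℝ)|) ^ 2)) = 1 := by field_simp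
            linarith
          have h4 : 0 ≤ 1 / l * (1 / (1 + |(k:ℝ)|) ^ 2) := by positivity
          have h5 := mul_le_mul_of_nonneg_right h3 (norm_nonneg (d k))
          nlinarith
    _ = l * ∑' k : ℤ, (1 + |(k:ℝ)|) ^ 2 * ‖d k‖ ^ 2 +
        ∑' k : ℤ, min ‖d k‖ (1 / l * (1 / (1 + |(k:ℝ)|) ^ 2)) := by
        rw [(h.summable_sq.mul_left l).tsum_add s2, tsum_mul_left]
    _ ≤ _ := by
        gcongr
        exact h.summable_sq.tsum_le_of_sum_le h

lemma summable_rot (hJ : ∀ x, J (J x) = -x) {d : ℤ → E} (h : Summable fun k => ‖d k‖) (t : ℝ) :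
    Summable fun k : ℤ => rot J (2 * Real.pi * k * t) (d k) :=
  Summable.of_norm (by simpa only [norm_rot hJ] using h)

lemma ser_sub_le (hJ : ∀ x, J (J x) = -x) {d d' : ℤ → E} (h : Summable fun k => ‖d k‖)
    (h' : Summable fun k => ‖d' k‖) (t : ℝ) :
    ‖ser J d t - ser J d' t‖ ≤ ∑' k, ‖d k - d' k‖ := by
  unfold ser
  rw [← (summable_rot hJ h t).tsum_sub (summable_rot hJ h' t)]
  have e : ∀ k : ℤ, rot J (2 * Real.pi * k * t) (d k) - rot J (2 * Real.pi * k * t) (d' k) =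
      rot J (2 * Real.pi * k * t) (d k - d' k) := by
    intro k; simp only [rot, map_sub]; module
  simp_rw [e]
  have hs : Summable fun k => ‖d k - d' k‖ :=
    Summable.of_nonneg_of_le (fun k => norm_nonneg _) (fun k => norm_sub_le _ _) (h.add h')
  refine (norm_tsum_le_tsum_norm ?_).trans_eq ?_
  · simpa only [norm_rot hJ] using hs
  · simp only [norm_rot hJ]

lemma norm_ser_le (hJ : ∀ x, J (J x) = -x) {d : ℤ → E} (h : Summable fun k => ‖d k‖) (t : ℝ) :
    ‖ser J d t‖ ≤ ∑' k, ‖d k‖ := by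
  unfold ser
  refine (norm_tsum_le_tsum_norm ?_).trans_eq ?_
  · simpa only [norm_rot hJ] using h
  · simp only [norm_rot hJ]

lemma continuous_ser (hJ : ∀ x, J (J x) = -x) {d : ℤ → E} (h : Summable fun k => ‖d k‖) :
    Continuous (ser J d) := by
  unfold ser
  refine continuous_tsum (fun k => Continuous.rot (by fun_prop) continuous_const) h fun k t => ?_
  rw [norm_rot hJ]

lemma ser_periodic (d : ℤ → E) (t : ℝ) : ser J d (t + 1) = ser J d t := by
  unfold ser; simp_rw [rot_periodic]

/-- dominated convergence along uniformly bounded, pointwise converging loops -/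
lemma tendsto_integral_comp {G : Type*} [NormedAddCommGroup G] [NormedSpace ℝ G]
    (F : ℝ × E → G) (hF : Continuous F) (x : ℕ → ℝ → E) (y : ℝ → E) (hx : ∀ j, Continuous (x j))
    (X : ℝ) (hb : ∀ j t, ‖x j t‖ ≤ X) (hl : ∀ t, Tendsto (fun j => x j t) atTop (𝓝 (y t))) :
    Tendsto (fun j => ∫ t in (0:ℝ)..1, F (t, x j t)) atTop (𝓝 (∫ t in (0:ℝ)..1, F (t, y t))) := by
  obtain ⟨B, hB⟩ := ((isCompact_Icc (a := (0:ℝ)) (b := 1)).prod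
    (isCompact_closedBall (0:E) X)).exists_bound_of_continuousOn hF.continuousOn
  refine intervalIntegral.tendsto_integral_filter_of_dominated_convergence (fun _ => B) ?_ ?_ ?_ ?_
  · refine Eventually.of_forall fun j => ?_
    have : Continuous fun t => F (t, x j t) := by have := hx j; fun_prop
    exact this.aestronglyMeasurable
  · refine Eventually.of_forall fun j => Eventually.of_forall fun t ht => ?_
    rw [uIoc_of_le zero_le_one] at ht
    exact hB _ ⟨⟨ht.1.le, ht.2⟩, by simpa using hb j t⟩
  · exact intervalIntegrable_const
  · refine Eventually.of_forall fun t _ => ?_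
    exact (hF.tendsto (t, y t)).comp (tendsto_const_nhds.prodMk_nhds (hl t))

lemma compactness {M : ℝ} (d : ℕ → ℤ → E) (hd : ∀ j, WS M (d j)) :
    ∃ d₀ : ℤ → E, WS M d₀ ∧ ∃ φ : ℕ → ℕ, StrictMono φ ∧
      Tendsto (fun j => ∑' k, ‖d (φ j) k - d₀ k‖) atTop (𝓝 0) := by
  have hM : 0 ≤ M := by simpa using hd 0 ∅
  have hcomp : IsCompact (Set.pi univ fun _ : ℤ => closedBall (0:E) (M + 1)) :=
    isCompact_univ_pi fun _ => isCompact_closedBall _ _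
  obtain ⟨d₀, _, φ, hφ, hlim⟩ := hcomp.tendsto_subseq (x := d)
    fun j => by
      intro k _
      simpa using (hd j).norm_le k
  have hlim' : ∀ k, Tendsto (fun j => d (φ j) k) atTop (𝓝 (d₀ k)) :=
    fun k => (tendsto_pi_nhds.1 hlim) k
  have hd₀ : WS M d₀ := by
    intro s
    refine le_of_tendsto (x := atTop) (f := fun j => ∑ k ∈ s, (1 + |(k:ℝ)|) ^ 2 * ‖d (φ j) k‖ ^ 2)
      (tendsto_finsetSum _ fun k _ => ?_) (Eventually.of_forall fun j => hd (φ j) s)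
    exact (((hlim' k).norm).pow 2).const_mul _
  refine ⟨d₀, hd₀, φ, hφ, ?_⟩
  rw [Metric.tendsto_atTop]
  intro ε hε
  let l := ε / (2 * (4 * M + 1))
  have hl : 0 < l := by positivity
  have hlM : l * (4 * M) < ε / 2 := by
    have : l * (4 * M + 1) = ε / 2 := by simp only [l]; field_simp
    linarith
  have hdc : Tendsto (fun j => ∑' k : ℤ, min ‖d (φ j) k - d₀ k‖ (1 / l * (1 / (1 + |(k:ℝ)|) ^ 2)))
      atTop (𝓝 (∑' k : ℤ, (0:ℝ))) := by
    refine tendsto_tsum_of_dominated_convergence (summable_wt.mul_left (1 / l)) (fun k => ?_)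
      (Eventually.of_forall fun j k => ?_)
    · have h1 : Tendsto (fun j => ‖d (φ j) k - d₀ k‖) atTop (𝓝 0) := by
        have := ((hlim' k).sub_const (d₀ k)).norm
        simpa using this
      have h2 := h1.min (tendsto_const_nhds (x := 1 / l * (1 / (1 + |(k:ℝ)|) ^ 2)))
      rwa [min_eq_left (by positivity)] at h2
    · rw [Real.norm_eq_abs, abs_of_nonneg (by positivity)]
      exact min_le_right _ _
  rw [tsum_zero, Metric.tendsto_atTop] at hdc
  obtain ⟨j₀, hj₀⟩ := hdc (ε / 2) (by positivity)
  refine ⟨j₀, fun j hj => ?_⟩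
  have h1 := hj₀ j hj
  have h2 := ((hd (φ j)).sub hd₀).tsum_norm_le l hl
  rw [Real.dist_eq, sub_zero] at h1 ⊢
  rw [abs_of_nonneg (tsum_nonneg fun k => norm_nonneg _)]
  have h3 := (le_abs_self _).trans_lt h1
  linarith

/-- Limits of approximate critical points are periodic orbits. -/
theorem limit (hJ : ∀ x, J (J x) = -x) {K : E → ℝ} {dK : E → E} {A : ℝ} (hK : Good K dK A) (a b : ℝ)
    (hseq : ∀ N₀ : ℕ, ∃ N ≥ N₀, ∃ c : XS E (SN N), ‖gPhi J dK c‖ ≤ 1 / ((N:ℝ) + 1) ∧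
      a ≤ Phi J K c ∧ Phi J K c ≤ b) :
    ∃ x : ℝ → E, (∀ t, HasDerivAt x (J (dK (x t))) t) ∧ (∀ t, x (t + 1) = x t) ∧
      a ≤ (1/2) * (∫ t in (0:ℝ)..1, ⟪dK (x t), x t⟫) - ∫ t in (0:ℝ)..1, K (x t) ∧
      (1/2) * (∫ t in (0:ℝ)..1, ⟪dK (x t), x t⟫) - (∫ t in (0:ℝ)..1, K (x t)) ≤ b := by
  have cK := hK.contK
  have cdK := hK.contdK
  choose N hN c hg ha hb using hseq
  obtain ⟨M, hM, hap⟩ := apriori (J := J) hJ hK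
  have hg1 : ∀ j : ℕ, ‖gPhi J dK (c j)‖ ≤ 1 / ((j:ℝ) + 1) := by
    intro j
    refine (hg j).trans ?_
    have : (j:ℝ) ≤ N j := by exact_mod_cast hN j
    gcongr
  have hws : ∀ j, WS M (ext0 (c j)) := fun j => WS_ext0 _ _ (hap _ _ ((hg1 j).trans (by
    rw [div_le_one (by positivity)]; linarith [(Nat.cast_nonneg j : (0:ℝ) ≤ j)])))
  obtain ⟨d₀, hd₀, φ, hφ, hlim⟩ := compactness _ hws
  let x : ℝ → E := ser J d₀
  have hxc : Continuous x := continuous_ser hJ hd₀.summable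
  have hxj : ∀ j, ser J (ext0 (c (φ j))) = ev J (c (φ j)) := fun j => funext fun t => ser_ext0 _ t
  let y : ℕ → ℝ → E := fun j => ev J (c (φ j))
  have hyc : ∀ j, Continuous (y j) := fun j => continuous_ev _
  have hdist : ∀ j t, ‖y j t - x t‖ ≤ ∑' k, ‖ext0 (c (φ j)) k - d₀ k‖ := by
    intro j t
    simp only [y, x]
    rw [← hxj]
    exact ser_sub_le hJ (hws _).summable hd₀.summable t
  have hyx : ∀ t, Tendsto (fun j => y j t) atTop (𝓝 (x t)) := by
    intro t
    rw [tendsto_iff_norm_sub_tendsto_zero]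
    exact squeeze_zero (fun _ => norm_nonneg _) (fun j => hdist j t) hlim
  obtain ⟨X, hX⟩ : ∃ X, ∀ j t, ‖y j t‖ ≤ X := by
    obtain ⟨C, hC⟩ := hlim.bddAbove_range
    refine ⟨C + ∑' k, ‖d₀ k‖, fun j t => ?_⟩
    have h1 := hdist j t
    have h2 : ∑' k, ‖ext0 (c (φ j)) k - d₀ k‖ ≤ C := hC ⟨j, rfl⟩
    have h3 := norm_ser_le hJ hd₀.summable t
    have h4 := norm_le_norm_add_norm_sub' (y j t) (x t)
    have h5 : ‖x t‖ ≤ _ := h3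
    linarith
  have hgl : Tendsto (fun j => ‖gPhi J dK (c (φ j))‖) atTop (𝓝 0) := by
    refine squeeze_zero (fun _ => norm_nonneg _) (fun j => hg1 (φ j)) ?_
    exact (tendsto_one_div_add_atTop_nhds_zero_nat (𝕜 := ℝ)).comp hφ.tendsto_atTop
  have px : ∀ t, x (t + 1) = x t := ser_periodic d₀
  refine ⟨x, ?_, px, ?_⟩
  · refine ode_of_coef hJ x (fun t => dK (x t)) hxc (cdK.comp hxc) px (fun t => by rw [px]) fun k => ?_
    have h1 := tendsto_integral_comp (fun p : ℝ × E => rot J (-(2 * Real.pi * k * p.1)) (dK p.2))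
      (Continuous.rot (by fun_prop) (by fun_prop)) y x hyc X hX hyx
    have h2 := tendsto_integral_comp (fun p : ℝ × E => rot J (-(2 * Real.pi * k * p.1)) p.2)
      (Continuous.rot (by fun_prop) (by fun_prop)) y x hyc X hX hyx
    have h3 := (h2.const_smul (2 * Real.pi * (k:ℝ))).sub h1
    have h4 : Tendsto (fun j => (2 * Real.pi * (k:ℝ)) • (∫ t in (0:ℝ)..1, rot J (-(2 * Real.pi * k * t)) (y j t))
        - ∫ t in (0:ℝ)..1, rot J (-(2 * Real.pi * k * t)) (dK (y j t))) atTop (𝓝 0) := by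
      rw [tendsto_zero_iff_norm_tendsto_zero]
      refine squeeze_zero' (Eventually.of_forall fun _ => norm_nonneg _) ?_ hgl
      filter_upwards [eventually_ge_atTop k.natAbs] with j hj
      have hk : k ∈ SN (N (φ j)) := by
        have h5 := hN (φ j)
        have h6 := hφ.id_le j
        simp only [id] at h6
        rw [Finset.mem_Icc]; omega
      have h7 := PiLp.norm_apply_le (gPhi J dK (c (φ j))) ⟨k, hk⟩
      rw [gPhi_apply, ← coef_ev hJ (c (φ j)) ⟨k, hk⟩] at h7
      exact h7
    have h5 := tendsto_nhds_unique h3 h4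
    exact (sub_eq_zero.1 h5).symm
  · have h1 := tendsto_integral_comp (fun p : ℝ × E => ⟪dK p.2, p.2⟫) (by fun_prop) y x hyc X hX hyx
    have h2 := tendsto_integral_comp (fun p : ℝ × E => K p.2) (by fun_prop) y x hyc X hX hyx
    have h3 : Tendsto (fun j => ⟪gPhi J dK (c (φ j)), c (φ j)⟫) atTop (𝓝 0) := by
      rw [tendsto_zero_iff_norm_tendsto_zero]
      refine squeeze_zero (fun _ => norm_nonneg _) (g := fun j => ‖gPhi J dK (c (φ j))‖ * (M + 1))
        (fun j => ?_) (by simpa using hgl.mul_const (M + 1))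
      refine (norm_inner_le_norm _ _).trans ?_
      gcongr
      have h4 : ‖c (φ j)‖ ^ 2 ≤ M := by
        rw [PiLp.norm_sq_eq_of_L2]
        refine le_trans (Finset.sum_le_sum fun k _ => ?_) (hap _ (c (φ j)) ((hg1 _).trans (by
          rw [div_le_one (by positivity)]; linarith [(Nat.cast_nonneg (φ j) : (0:ℝ) ≤ (φ j : ℕ))])))
        have : 1 ≤ (1 + |((k:ℤ):ℝ)|) ^ 2 := by nlinarith [abs_nonneg ((k:ℤ):ℝ)]
        nlinarith [sq_nonneg ‖(c (φ j)) k‖]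
      nlinarith [sq_nonneg (‖c (φ j)‖ - 1)]
    have h4 : Tendsto (fun j => Phi J K (c (φ j))) atTop
        (𝓝 ((1/2) * (∫ t in (0:ℝ)..1, ⟪dK (x t), x t⟫) - ∫ t in (0:ℝ)..1, K (x t))) := by
      have := ((h1.const_mul (1/2)).add (h3.const_mul (1/2))).sub h2
      rw [mul_zero, add_zero] at this
      refine this.congr fun j => ?_
      rw [Phi_eq hJ cdK]
    exact ⟨ge_of_tendsto h4 (Eventually.of_forall fun j => ha _),
      le_of_tendsto h4 (Eventually.of_forall fun j => hb _)⟩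

end LT
end HZ

namespace HZ
open MeasureTheory Filter
set_option linter.unusedSectionVars false

section MM
variable {E : Type*} [NormedAddCommGroup E] [InnerProductSpace ℝ E] [FiniteDimensional ℝ E]
variable {J : E ≃ₗᵢ[ℝ] E}

/-- nonpositive modes -/
abbrev YN (N : ℕ) : Finset ℤ := Finset.Icc (-(N:ℤ)) 0

/-- the half-space used for the minimax -/
def iota (N : ℕ) (e : E) (v : XS E (YN N) × ℝ) : XS E (SN N) :=
  WithLp.toLp 2 fun k : SN N => if (k:ℤ) = 1 then (max v.2 0) • e else ext0 v.1 k

/-- projection to nonpositive modes -/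
def projY (N : ℕ) (c : XS E (SN N)) : XS E (YN N) := WithLp.toLp 2 fun k : YN N => ext0 c k

/-- square of the norm of the positive part -/
def posSq (N : ℕ) (c : XS E (SN N)) : ℝ := ∑ k : SN N, if 0 < (k:ℤ) then ‖c k‖ ^ 2 else 0

lemma continuous_ext0 {S : Finset ℤ} (k : ℤ) : Continuous fun c : XS E S => ext0 c k := by
  unfold ext0
  split_ifs with h
  · fun_prop
  · exact continuous_const

lemma continuous_iota (N : ℕ) (e : E) : Continuous (iota N e) := by
  unfold iota
  refine (PiLp.continuous_toLp 2 _).comp (continuous_pi fun k => ?_)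
  split_ifs with h
  · fun_prop
  · exact (continuous_ext0 _).comp continuous_fst

lemma continuous_projY (N : ℕ) : Continuous (projY (E := E) N) := by
  unfold projY
  refine (PiLp.continuous_toLp 2 _).comp (continuous_pi fun k => continuous_ext0 _)

lemma continuous_posSq (N : ℕ) : Continuous (posSq (E := E) N) := by
  unfold posSq
  refine continuous_finsetSum _ fun k _ => ?_
  split_ifs with h
  · fun_prop
  · exact continuous_const

lemma iota_apply (N : ℕ) (e : E) (v : XS E (YN N) × ℝ) (k : SN N) :
    iota N e v k = if (k:ℤ) = 1 then (max v.2 0) • e else ext0 v.1 k := rfl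

lemma projY_iota (N : ℕ) (e : E) (v : XS E (YN N) × ℝ) : projY N (iota N e v) = v.1 := by
  ext k
  have hk := Finset.mem_Icc.1 k.2
  have hk' : (k:ℤ) ∈ SN N := by rw [Finset.mem_Icc]; omega
  change ext0 (iota N e v) k = _
  rw [show ext0 (iota N e v) (k:ℤ) = iota N e v ⟨k, hk'⟩ from ext0_mem _ ⟨(k:ℤ), hk'⟩, iota_apply,
    if_neg (by simp only; omega)]
  simp only [ext0_mem]

lemma sum_one {N : ℕ} (hN : 1 ≤ N) (x : ℝ) : ∑ k : SN N, (if (k:ℤ) = 1 then x else 0) = x := by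
  rw [Finset.sum_coe_sort (SN N) (fun k : ℤ => if k = 1 then x else 0), Finset.sum_ite_eq',
    if_pos]
  rw [Finset.mem_Icc]; omega

lemma ext0_Y_pos {N : ℕ} (y : XS E (YN N)) {k : ℤ} (hk : 0 < k) : ext0 y k = 0 :=
  ext0_not_mem y (by rw [Finset.mem_Icc]; omega)

lemma posSq_iota {N : ℕ} (hN : 1 ≤ N) (e : E) (he : ‖e‖ = 1) (v : XS E (YN N) × ℝ) :
    posSq N (iota N e v) = (max v.2 0) ^ 2 := by
  rw [← sum_one hN ((max v.2 0) ^ 2), posSq]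
  refine Finset.sum_congr rfl fun k _ => ?_
  rw [iota_apply]
  by_cases h1 : (k:ℤ) = 1
  · simp [h1, norm_smul, he]
  · simp only [h1, if_false]
    by_cases h2 : 0 < (k:ℤ)
    · rw [if_pos h2, ext0_Y_pos _ h2]; simp
    · rw [if_neg h2]

lemma quad_iota {N : ℕ} (hN : 1 ≤ N) (e : E) (he : ‖e‖ = 1) (v : XS E (YN N) × ℝ) :
    quad (iota N e v) ≤ (max v.2 0) ^ 2 := by
  rw [← sum_one hN ((max v.2 0) ^ 2), quad]
  refine Finset.sum_le_sum fun k _ => ?_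
  rw [iota_apply]
  by_cases h1 : (k:ℤ) = 1
  · simp [h1, norm_smul, he]
  · simp only [h1, if_false]
    by_cases h2 : 0 < (k:ℤ)
    · rw [ext0_Y_pos _ h2]; simp
    · have : ((k:ℤ):ℝ) ≤ 0 := by exact_mod_cast not_lt.1 h2
      exact mul_nonpos_of_nonpos_of_nonneg this (by positivity)

lemma norm_iota {N : ℕ} (hN : 1 ≤ N) (e : E) (he : ‖e‖ = 1) (v : XS E (YN N) × ℝ) :
    ‖iota N e v‖ ^ 2 = (max v.2 0) ^ 2 + ‖v.1‖ ^ 2 := by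
  rw [← sum_one hN ((max v.2 0) ^ 2), PiLp.norm_sq_eq_of_L2, PiLp.norm_sq_eq_of_L2]
  have e1 : ∑ k : YN N, ‖v.1 k‖ ^ 2 = ∑ k : SN N, ‖ext0 v.1 k‖ ^ 2 := by
    rw [Finset.sum_coe_sort (SN N) (fun k : ℤ => ‖ext0 v.1 k‖ ^ 2)]
    calc _ = ∑ k ∈ YN N, ‖ext0 v.1 k‖ ^ 2 := by
          rw [← Finset.sum_coe_sort (YN N)]
          exact Finset.sum_congr rfl fun k _ => by rw [ext0_mem]
      _ = _ := by
          refine Finset.sum_subset ?_ fun k _ hk => ?_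
          · intro k hk
            rw [Finset.mem_Icc] at hk ⊢; omega
          · rw [ext0_not_mem _ hk]; simp
  rw [e1, ← Finset.sum_add_distrib]
  refine Finset.sum_congr rfl fun k _ => ?_
  rw [iota_apply]
  by_cases h1 : (k:ℤ) = 1
  · simp only [h1, if_true]
    rw [ext0_Y_pos _ (by norm_num)]
    simp [norm_smul, he]
  · simp [h1]

/-- upper estimates on the half space -/
lemma Phi_iota (hJ : ∀ x, J (J x) = -x) {K : E → ℝ} (cK : Continuous K) (h0 : ∀ z, 0 ≤ K z)
    {ε C₀ : ℝ} (hlow : ∀ z, (Real.pi + ε) * ‖z‖ ^ 2 - C₀ ≤ K z)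
    {N : ℕ} (hN : 1 ≤ N) (e : E) (he : ‖e‖ = 1) (v : XS E (YN N) × ℝ) :
    Phi J K (iota N e v) ≤ Real.pi * (max v.2 0) ^ 2 ∧
    Phi J K (iota N e v) ≤ C₀ - ε * (max v.2 0) ^ 2 - (Real.pi + ε) * ‖v.1‖ ^ 2 := by
  have hq := quad_iota hN e he v
  have hce := continuous_ev (J := J) (iota N e v)
  have i0 : 0 ≤ ∫ t in (0:ℝ)..1, K (ev J (iota N e v) t) :=
    intervalIntegral.integral_nonneg zero_le_one fun t _ => h0 _
  have i1 : ∫ t in (0:ℝ)..1, ((Real.pi + ε) * ‖ev J (iota N e v) t‖ ^ 2 - C₀) ≤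
      ∫ t in (0:ℝ)..1, K (ev J (iota N e v) t) := by
    refine intervalIntegral.integral_mono_on zero_le_one ?_ ?_ fun t _ => hlow _
    · apply Continuous.intervalIntegrable; fun_prop
    · apply Continuous.intervalIntegrable; fun_prop
  rw [intervalIntegral.integral_sub (by apply Continuous.intervalIntegrable; fun_prop)
    (by simp), intervalIntegral.integral_const_mul, integral_ev_sq hJ, norm_iota hN e he] at i1
  simp only [intervalIntegral.integral_const, sub_zero, one_smul] at i1
  have hp := mul_le_mul_of_nonneg_left hq Real.pi_pos.le
  unfold Phi
  constructor
  · linarith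
  · linarith

/-- lower estimate on the linking sphere -/
lemma Phi_Gamma (hJ : ∀ x, J (J x) = -x) {G : E → ℝ} (cG : Continuous G) {r₁ C' : ℝ} (hC' : 0 ≤ C')
    (hup : ∀ z, G z ≤ C' * (max (‖z‖ - r₁) 0) ^ 2) {m : ℕ} (hm : C' ≤ Real.pi * m) {ρ : ℝ} (hρ : 0 < ρ)
    (hmρ : m * ρ ≤ r₁) {N : ℕ} (c : XS E (SN N)) (h1 : projY N c = 0) (h2 : posSq N c = ρ ^ 2) :
    Real.pi * ρ ^ 2 ≤ Phi J G c := by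
  have c0 : ∀ k : SN N, (k:ℤ) ≤ 0 → c k = 0 := by
    intro k hk
    have hk' := Finset.mem_Icc.1 k.2
    have hY : (k:ℤ) ∈ YN N := by rw [Finset.mem_Icc]; omega
    have := congrArg (fun y : XS E (YN N) => y ⟨k, hY⟩) h1
    simp only at this
    change ext0 c k = 0 at this
    rwa [ext0_mem] at this
  have hnorm : ‖c‖ ^ 2 = ρ ^ 2 := by
    rw [← h2, PiLp.norm_sq_eq_of_L2, posSq]
    refine Finset.sum_congr rfl fun k _ => ?_
    split_ifs with h
    · rfl
    · rw [c0 k (not_lt.1 h)]; simp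
  have hcn : ‖c‖ = ρ := (sq_eq_sq₀ (norm_nonneg _) hρ.le).1 hnorm
  let u : XS E (SN N) := WithLp.toLp 2 fun k : SN N => if (k:ℤ) ≤ m then c k else 0
  let w : XS E (SN N) := WithLp.toLp 2 fun k : SN N => if (k:ℤ) ≤ m then 0 else c k
  have uk : ∀ k, u k = if (k:ℤ) ≤ m then c k else 0 := fun k => rfl
  have wk : ∀ k, w k = if (k:ℤ) ≤ m then 0 else c k := fun k => rfl
  have cuw : c = u + w := by
    ext k
    rw [PiLp.add_apply, uk, wk]
    split_ifs <;> simp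
  have hu : ∀ t, ‖ev J u t‖ ≤ r₁ := by
    intro t
    unfold ev
    refine (norm_sum_le _ _).trans (le_trans ?_ hmρ)
    simp only [norm_rot hJ]
    calc ∑ k : SN N, ‖u k‖ ≤ ∑ k : SN N, (if (k:ℤ) ∈ Finset.Icc (1:ℤ) m then ρ else 0) := by
          refine Finset.sum_le_sum fun k _ => ?_
          rw [uk]
          by_cases h : (k:ℤ) ≤ m
          · rw [if_pos h]
            by_cases h' : (k:ℤ) ≤ 0
            · rw [c0 k h', norm_zero]; split_ifs <;> linarith
            · rw [if_pos (by rw [Finset.mem_Icc]; omega), ← hcn]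
              exact PiLp.norm_apply_le c k
          · rw [if_neg h, norm_zero]; split_ifs <;> linarith
      _ = ∑ k ∈ SN N, (if k ∈ Finset.Icc (1:ℤ) m then ρ else 0) :=
          Finset.sum_coe_sort (SN N) (fun k : ℤ => if k ∈ Finset.Icc (1:ℤ) m then ρ else 0)
      _ = ∑ k ∈ SN N ∩ Finset.Icc (1:ℤ) m, ρ := Finset.sum_ite_mem _ _ _
      _ ≤ ∑ k ∈ Finset.Icc (1:ℤ) m, ρ :=
          Finset.sum_le_sum_of_subset_of_nonneg Finset.inter_subset_right fun _ _ _ => hρ.le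
      _ = m * ρ := by simp
  have hcc := continuous_ev (J := J) c
  have hwc := continuous_ev (J := J) w
  have hintg : ∫ t in (0:ℝ)..1, G (ev J c t) ≤ C' * ‖w‖ ^ 2 := by
    rw [← integral_ev_sq hJ w, ← intervalIntegral.integral_const_mul]
    refine intervalIntegral.integral_mono_on zero_le_one ?_ ?_ fun t _ => ?_
    · apply Continuous.intervalIntegrable; fun_prop
    · apply Continuous.intervalIntegrable; fun_prop
    · refine (hup _).trans ?_
      gcongr
      refine max_le ?_ (norm_nonneg _)
      rw [cuw, ev_add]
      have := norm_add_le (ev J u t) (ev J w t)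
      linarith [hu t]
  have hquad : ρ ^ 2 + m * ‖w‖ ^ 2 ≤ quad c := by
    rw [← hnorm, PiLp.norm_sq_eq_of_L2, PiLp.norm_sq_eq_of_L2, Finset.mul_sum,
      ← Finset.sum_add_distrib, quad]
    refine Finset.sum_le_sum fun k _ => ?_
    rw [wk]
    by_cases h0 : (k:ℤ) ≤ 0
    · rw [c0 k h0]; simp
    have h0' : (1:ℝ) ≤ ((k:ℤ):ℝ) := by exact_mod_cast (by omega : (1:ℤ) ≤ k)
    by_cases h : (k:ℤ) ≤ m
    · rw [if_pos h]
      have := sq_nonneg ‖c k‖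
      simp only [norm_zero]
      nlinarith
    · rw [if_neg h]
      have h3 : (m:ℝ) + 1 ≤ ((k:ℤ):ℝ) := by exact_mod_cast (by omega : (m:ℤ) + 1 ≤ k)
      have := sq_nonneg ‖c k‖
      nlinarith
  unfold Phi
  have h3 := mul_le_mul_of_nonneg_left hquad Real.pi_pos.le
  have h4 := mul_le_mul_of_nonneg_right hm (sq_nonneg ‖w‖)
  nlinarith

lemma Phi_mono {K G : E → ℝ} (cK : Continuous K) (cG : Continuous G) (h : ∀ z, K z ≤ G z)
    {S : Finset ℤ} (c : XS E S) : Phi J G c ≤ Phi J K c := by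
  have hcc := continuous_ev (J := J) c
  have : ∫ t in (0:ℝ)..1, K (ev J c t) ≤ ∫ t in (0:ℝ)..1, G (ev J c t) := by
    refine intervalIntegral.integral_mono_on zero_le_one ?_ ?_ fun t _ => h _
    · apply Continuous.intervalIntegrable; fun_prop
    · apply Continuous.intervalIntegrable; fun_prop
  unfold Phi
  linarith

/-- one-periodic solutions -/
def IsSol (J : E ≃ₗᵢ[ℝ] E) (dK : E → E) (x : ℝ → E) : Prop :=
  (∀ t, HasDerivAt x (J (dK (x t))) t) ∧ ∀ t, x (t + 1) = x t

/-- the action of a one-periodic solution -/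
def act (K : E → ℝ) (dK : E → E) (x : ℝ → E) : ℝ :=
  (1/2) * (∫ t in (0:ℝ)..1, ⟪dK (x t), x t⟫) - ∫ t in (0:ℝ)..1, K (x t)

lemma noncrit (hJ : ∀ x, J (J x) = -x) {K : E → ℝ} {dK : E → E} {A : ℝ} (hK : Good K dK A) (a b : ℝ)
    (h : ∀ x, IsSol J dK x → a ≤ act K dK x → act K dK x ≤ b → False) :
    ∃ N₀ : ℕ, ∀ N ≥ N₀, ∀ c : XS E (SN N), a ≤ Phi J K c → Phi J K c ≤ b →
      1 / ((N:ℝ) + 1) ≤ ‖gPhi J dK c‖ := by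
  by_contra hcon
  push Not at hcon
  obtain ⟨x, h1, h2, h3, h4⟩ := limit hJ hK a b (fun N₀ => by
    obtain ⟨N, hN, c, ha, hb, hg⟩ := hcon N₀
    exact ⟨N, hN, c, hg.le, ha, hb⟩)
  exact h x ⟨h1, h2⟩ h3 h4

theorem minimax (hJ : ∀ x, J (J x) = -x) {K G : E → ℝ} {dK dG : E → E} {A A' : ℝ}
    (hK : Good K dK A) (hG : Good G dG A') (hKG : ∀ z, K z ≤ G z) (h0 : ∀ z, 0 ≤ K z)
    {ε C₀ : ℝ} (hε : 0 < ε) (hC₀ : 0 ≤ C₀) (hlow : ∀ z, (Real.pi + ε) * ‖z‖ ^ 2 - C₀ ≤ K z)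
    {r₁ C' : ℝ} (hr₁ : 0 < r₁) (hC' : 0 ≤ C')
    (hup : ∀ z, G z ≤ C' * (max (‖z‖ - r₁) 0) ^ 2) (e : E) (he : ‖e‖ = 1) (a : ℝ) (ha : 0 < a)
    (hGact : ∀ x, IsSol J dG x → 0 < act G dG x → act G dG x ≤ a → False) :
    ∃ x, IsSol J dK x ∧ a ≤ act K dK x := by
  by_contra hcon
  push Not at hcon
  obtain ⟨m, hm⟩ := exists_nat_ge (C' / Real.pi)
  have hm' : C' ≤ Real.pi * m := by
    rw [div_le_iff₀ Real.pi_pos] at hm; linarith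
  let ρ := r₁ / (m + 1)
  have hρ : 0 < ρ := by positivity
  have hmρ : m * ρ ≤ r₁ := by
    have : (m + 1) * ρ = r₁ := by simp only [ρ]; field_simp
    linarith
  let β := Real.pi * ρ ^ 2
  have hβ : 0 < β := by have := Real.pi_pos; positivity
  obtain ⟨N₀, hN₀⟩ := noncrit hJ hK a C₀ fun x hx h1 _ => absurd h1 (not_le.2 (hcon x hx))
  obtain ⟨N₁, hN₁⟩ := noncrit hJ hG β a fun x hx h1 h2 => hGact x hx (hβ.trans_le h1) h2
  let N := max (max N₀ N₁) 1
  have hN : 1 ≤ N := le_max_right _ _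
  have hNN₀ : N₀ ≤ N := (le_max_left _ _).trans (le_max_left _ _)
  have hNN₁ : N₁ ≤ N := (le_max_right _ _).trans (le_max_left _ _)
  obtain ⟨L, hL, hd⟩ := Phi_desc hJ hK N
  obtain ⟨L', hL', hd'⟩ := Phi_desc hJ hG N
  let τ := C₀ / ε + 1
  have hτ : C₀ ≤ ε * τ ^ 2 := by
    have h1 : ε * (C₀ / ε) = C₀ := by field_simp
    have h2 : 0 ≤ C₀ / ε := by positivity
    have h3 : C₀ / ε ≤ τ ^ 2 := by simp only [τ]; nlinarith
    have := mul_le_mul_of_nonneg_left h3 hε.le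
    linarith
  have hτ0 : 0 < τ := by positivity
  have hι := Phi_iota hJ hK.contK h0 hlow hN e he
  have hout : ∀ v : XS E (YN N) × ℝ, (v.2 ≤ 0 ∨ τ ≤ ‖v‖) → Phi J K (iota N e v) ≤ 0 := by
    intro v hv
    rcases le_or_gt v.2 0 with h | h
    · have := (hι v).1
      rw [max_eq_right h] at this
      simpa using this
    · have hv' : τ ≤ ‖v‖ := hv.resolve_left (not_le.2 h)
      have h2 := (hι v).2
      rw [max_eq_left h.le] at h2
      have hp := Real.pi_pos
      have h3 : τ ^ 2 ≤ v.2 ^ 2 + ‖v.1‖ ^ 2 := by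
        rw [Prod.norm_def] at hv'
        rcases le_max_iff.1 hv' with h' | h'
        · nlinarith [sq_nonneg v.2]
        · rw [Real.norm_eq_abs, abs_of_pos h] at h'
          nlinarith [sq_nonneg ‖v.1‖]
      nlinarith [sq_nonneg ‖v.1‖, mul_le_mul_of_nonneg_left h3 hε.le, mul_nonneg hp.le (sq_nonneg ‖v.1‖)]
  have hub : ∀ v : XS E (YN N) × ℝ, Phi J K (iota N e v) ≤ C₀ := by
    intro v
    have h2 := (hι v).2
    have hp := Real.pi_pos
    have h3 : 0 ≤ ε * (max v.2 0) ^ 2 := by positivity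
    have h4 : 0 ≤ (Real.pi + ε) * ‖v.1‖ ^ 2 := by positivity
    linarith
  obtain ⟨h', ch', h'1, h'2⟩ := deform (Phi J K) (gPhi J dK) L hL (continuous_Phi hK.contK)
    (continuous_gPhi hK.contdK) hd a C₀ (1 / ((N:ℝ) + 1)) ha (by positivity) (hN₀ N hNN₀)
    (iota N e) (continuous_iota N e) hub
  have hmono : ∀ c : XS E (SN N), Phi J G c ≤ Phi J K c := Phi_mono hK.contK hG.contK hKG
  obtain ⟨h'', ch'', h''1, h''2⟩ := deform (Phi J G) (gPhi J dG) L' hL' (continuous_Phi hG.contK)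
    (continuous_gPhi hG.contdK) hd' β a (1 / ((N:ℝ) + 1)) hβ (by positivity) (hN₁ N hNN₁)
    h' ch' fun v => (hmono _).trans (h'2 v).le
  obtain ⟨v, hv1, hv2⟩ := linking (fun v => projY N (h'' v)) (fun v => Real.sqrt (posSq N (h'' v)))
    ((continuous_projY N).comp ch'') (Real.continuous_sqrt.comp ((continuous_posSq N).comp ch''))
    τ ρ hρ (fun v hv => by
      have e1 := hout v hv
      have e2 := h'1 v e1
      have e3 := h''1 v (by rw [e2]; exact (hmono _).trans e1)
      rw [e3, e2, projY_iota, posSq_iota hN e he]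
      exact ⟨rfl, Real.sqrt_sq (le_max_right _ _)⟩)
  have hps : posSq N (h'' v) = ρ ^ 2 := by
    rw [← hv2, Real.sq_sqrt]
    refine Finset.sum_nonneg fun k _ => ?_
    split_ifs <;> positivity
  have := Phi_Gamma hJ hG.contK hC' hup hm' hρ hmρ (h'' v) hv1 hps
  exact absurd (h''2 v) (not_lt.2 this)

end MM
end HZ

namespace HZ
open MeasureTheory Filter
set_option linter.unusedSectionVars false

section Prof

/-- slope of the radial profile -/
def slope (A s₀ w s : ℝ) : ℝ := A * Real.smoothTransition ((s - s₀) / w)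

/-- radial profile -/
def prof (A s₀ w s : ℝ) : ℝ := ∫ u in s₀..s, slope A s₀ w u

variable {A s₀ w : ℝ}

lemma continuous_slope : Continuous (slope A s₀ w) := by
  unfold slope
  have := Real.smoothTransition.continuous
  fun_prop

lemma contDiff_slope {m : ℕ∞} : ContDiff ℝ m (slope A s₀ w) := by
  unfold slope
  exact contDiff_const.mul (Real.smoothTransition.contDiff.comp (by fun_prop))

lemma slope_mono (hA : 0 ≤ A) (hw : 0 < w) : Monotone (slope A s₀ w) := by
  intro s t hst
  unfold slope
  refine mul_le_mul_of_nonneg_left (Real.smoothTransition.monotone ?_) hA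
  gcongr

lemma slope_nonneg (hA : 0 ≤ A) (s : ℝ) : 0 ≤ slope A s₀ w s :=
  mul_nonneg hA (Real.smoothTransition.nonneg _)

lemma slope_le (hA : 0 ≤ A) (s : ℝ) : slope A s₀ w s ≤ A :=
  mul_le_of_le_one_right hA (Real.smoothTransition.le_one _)

lemma slope_zero (hw : 0 < w) {s : ℝ} (hs : s ≤ s₀) : slope A s₀ w s = 0 := by
  unfold slope
  rw [Real.smoothTransition.zero_of_nonpos, mul_zero]
  exact div_nonpos_of_nonpos_of_nonneg (by linarith) hw.le

lemma slope_top (hw : 0 < w) {s : ℝ} (hs : s₀ + w ≤ s) : slope A s₀ w s = A := by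
  unfold slope
  rw [Real.smoothTransition.one_of_one_le, mul_one]
  rw [le_div_iff₀ hw]; linarith

lemma hasDerivAt_prof (s : ℝ) : HasDerivAt (prof A s₀ w) (slope A s₀ w s) s :=
  intervalIntegral.integral_hasDerivAt_right (continuous_slope.intervalIntegrable _ _)
    (continuous_slope.stronglyMeasurableAtFilter _ _) continuous_slope.continuousAt

lemma continuous_prof : Continuous (prof A s₀ w) :=
  continuous_iff_continuousAt.2 fun s => (hasDerivAt_prof s).continuousAt

lemma prof_tangent (hA : 0 ≤ A) (hw : 0 < w) (s t : ℝ) :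
    prof A s₀ w s + slope A s₀ w s * (t - s) ≤ prof A s₀ w t := by
  have e : prof A s₀ w t - prof A s₀ w s = ∫ u in s..t, slope A s₀ w u :=
    intervalIntegral.integral_interval_sub_left (continuous_slope.intervalIntegrable _ _)
      (continuous_slope.intervalIntegrable _ _)
  rcases le_total s t with h | h
  · have := intervalIntegral.integral_mono_on (μ := volume) h
      (intervalIntegrable_const (c := slope A s₀ w s))
      (continuous_slope.intervalIntegrable _ _) (fun u hu => slope_mono hA hw hu.1)
    rw [intervalIntegral.integral_const, smul_eq_mul] at this
    linarith
  · have := intervalIntegral.integral_mono_on (μ := volume) h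
      (continuous_slope.intervalIntegrable _ _)
      (intervalIntegrable_const (c := slope A s₀ w s)) (fun u hu => slope_mono hA hw hu.2)
    rw [intervalIntegral.integral_const, smul_eq_mul] at this
    rw [intervalIntegral.integral_symm] at e
    linarith

lemma prof_base : prof A s₀ w s₀ = 0 := by simp [prof]

lemma prof_nonneg (hA : 0 ≤ A) (hw : 0 < w) (s : ℝ) : 0 ≤ prof A s₀ w s := by
  have := prof_tangent (s₀ := s₀) hA hw s₀ s
  rw [prof_base, slope_zero hw le_rfl] at this
  linarith

lemma prof_le (hA : 0 ≤ A) (hw : 0 < w) (s : ℝ) : prof A s₀ w s ≤ slope A s₀ w s * (s - s₀) := by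
  have := prof_tangent (s₀ := s₀) hA hw s s₀
  rw [prof_base] at this
  linarith

lemma prof_zero (hA : 0 ≤ A) (hw : 0 < w) {s : ℝ} (hs : s ≤ s₀) : prof A s₀ w s = 0 := by
  refine le_antisymm ?_ (prof_nonneg hA hw s)
  have := prof_le (s₀ := s₀) hA hw s
  rwa [slope_zero hw hs, zero_mul] at this

lemma prof_ge (hA : 0 ≤ A) (hw : 0 < w) (s : ℝ) : A * (s - s₀ - w) ≤ prof A s₀ w s := by
  have := prof_tangent (s₀ := s₀) hA hw (s₀ + w) s
  rw [slope_top hw le_rfl] at this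
  have h2 := prof_nonneg (s₀ := s₀) hA hw (s₀ + w)
  linarith

end Prof

section Ham
variable {E : Type*} [NormedAddCommGroup E] [InnerProductSpace ℝ E] [FiniteDimensional ℝ E]
variable {J : E ≃ₗᵢ[ℝ] E}

lemma gap_half (m : ℕ) : ∃ c > 0, ∀ k : ℤ, c * (1 + |(k:ℝ)|) ≤
    |2 * Real.pi * k - 2 * (Real.pi * (m + 1/2))| := by
  refine ⟨Real.pi / (m + 2), by have := Real.pi_pos; positivity, fun k => ?_⟩
  have e : 2 * Real.pi * k - 2 * (Real.pi * (m + 1/2)) = Real.pi * ((2 * (k - m) - 1 : ℤ) : ℝ) := by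
    push_cast; ring
  rw [e, abs_mul, abs_of_pos Real.pi_pos, div_mul_eq_mul_div, mul_div_assoc]
  refine mul_le_mul_of_nonneg_left ?_ Real.pi_pos.le
  rw [div_le_iff₀ (by positivity)]
  have h : (1 + |k|) ≤ |2 * (k - m) - 1| * ((m:ℤ) + 2) := by
    have h1 : 1 ≤ |2 * (k - (m:ℤ)) - 1| := by
      rcases abs_cases (2 * (k - (m:ℤ)) - 1) with h | h <;> omega
    have h2 : 2 * |k| - 2 * m - 1 ≤ |2 * (k - (m:ℤ)) - 1| := by
      rcases abs_cases (2 * (k - (m:ℤ)) - 1) with h | h <;> rcases abs_cases k with h' | h' <;> omega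
    have h3 : (0:ℤ) ≤ m := by positivity
    rcases le_or_gt |k| (m + 1) with h4 | h4
    · nlinarith
    · nlinarith
  exact_mod_cast h

/-- Hamiltonians of the form radial profile plus bounded perturbation. -/
lemma good_rad {F : E → ℝ} {dF : E → E} (cF : Continuous F) (cdF : Continuous dF)
    (hd : ∃ L > 0, ∀ z w, F z + ⟪dF z, w⟫ - L * ‖w‖ ^ 2 ≤ F (z + w)) (hb : ∃ B, ∀ z, ‖dF z‖ ≤ B)
    (m : ℕ) {s₀ w : ℝ} (hw : 0 < w) :
    Good (fun z => F z + prof (Real.pi * (m + 1/2)) s₀ w (‖z‖ ^ 2))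
      (fun z => dF z + (2 * slope (Real.pi * (m + 1/2)) s₀ w (‖z‖ ^ 2)) • z) (Real.pi * (m + 1/2)) := by
  have hA : 0 ≤ Real.pi * (m + 1/2) := by have := Real.pi_pos; positivity
  set A := Real.pi * ((m:ℝ) + 1/2) with hAdef
  have cp := continuous_prof (A := A) (s₀ := s₀) (w := w)
  have cs := continuous_slope (A := A) (s₀ := s₀) (w := w)
  refine ⟨by fun_prop, by fun_prop, ?_, ?_, gap_half m⟩
  · obtain ⟨L, hL, h⟩ := hd
    refine ⟨L, hL, fun z v => ?_⟩
    have h1 := h z v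
    have h2 := prof_tangent (s₀ := s₀) hA hw (‖z‖ ^ 2) (‖z + v‖ ^ 2)
    have h3 := slope_nonneg (s₀ := s₀) (w := w) hA (‖z‖ ^ 2)
    rw [norm_add_sq_real] at h2
    rw [norm_add_sq_real, inner_add_left, real_inner_smul_left]
    nlinarith [mul_nonneg h3 (sq_nonneg ‖v‖)]
  · obtain ⟨B, hB⟩ := hb
    refine ⟨B + 2 * A * (1 + |s₀ + w|), fun z => ?_⟩
    have e : dF z + (2 * slope A s₀ w (‖z‖ ^ 2)) • z - (2 * A) • z =
        dF z - (2 * (A - slope A s₀ w (‖z‖ ^ 2))) • z := by module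
    rw [e]
    refine (norm_sub_le _ _).trans (add_le_add (hB z) ?_)
    have h1 := slope_nonneg (s₀ := s₀) (w := w) hA (‖z‖ ^ 2)
    have h2 := slope_le (s₀ := s₀) (w := w) hA (‖z‖ ^ 2)
    rw [norm_smul, Real.norm_eq_abs, abs_of_nonneg (by linarith)]
    rcases le_or_gt (s₀ + w) (‖z‖ ^ 2) with h | h
    · rw [slope_top hw h, sub_self, mul_zero, zero_mul]; positivity
    · have h3 : ‖z‖ ≤ 1 + |s₀ + w| := by
        have := le_abs_self (s₀ + w)
        nlinarith [sq_nonneg (‖z‖ - 1), norm_nonneg z]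
      have := norm_nonneg z
      gcongr
      linarith

/-- smooth compactly supported functions -/
lemma smooth_desc {F : E → ℝ} (hF : ContDiff ℝ (⊤ : ℕ∞) F) (hc : HasCompactSupport F) :
    Continuous (gradient F) ∧ (∃ L > 0, ∀ z w, F z + ⟪gradient F z, w⟫ - L * ‖w‖ ^ 2 ≤ F (z + w)) ∧
      (∃ L > 0, ∀ z w, (-F z) + ⟪-gradient F z, w⟫ - L * ‖w‖ ^ 2 ≤ -F (z + w)) ∧
      ∃ B, ∀ z, ‖gradient F z‖ ≤ B := by
  have hdf : ContDiff ℝ 1 (fderiv ℝ F) := hF.fderiv_right (m := 1) (by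
    rw [show ((1 : WithTop ℕ∞) + 1) = ((2 : ℕ∞) : WithTop ℕ∞) from rfl]
    exact WithTop.coe_le_coe.2 le_top)
  have hdc := hc.fderiv ℝ
  have hdiff : Differentiable ℝ F := hF.differentiable (by simp)
  obtain ⟨C, hC⟩ := hdf.lipschitzWith_of_hasCompactSupport hdc one_ne_zero
  have hgc : Continuous (gradient F) := by
    unfold gradient
    exact (LinearIsometryEquiv.continuous _).comp hdf.continuous
  have hin : ∀ z w, ⟪gradient F z, w⟫ = fderiv ℝ F z w := by
    intro z w
    rw [gradient, InnerProductSpace.toDual_symm_apply]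
  have key : ∀ z w, ‖F (z + w) - F z - fderiv ℝ F z w‖ ≤ (C + 1) * ‖w‖ ^ 2 := by
    intro z w
    have := Convex.norm_image_sub_le_of_norm_hasFDerivWithin_le' (f := F) (f' := fderiv ℝ F)
      (φ := fderiv ℝ F z) (C := (C + 1) * ‖w‖) (s := closedBall z ‖w‖) (x := z) (y := z + w)
      (fun x _ => (hdiff x).hasFDerivAt.hasFDerivWithinAt) (fun x hx => ?_) (convex_closedBall _ _)
      (by simp) (by simp)
    · rw [add_sub_cancel_left] at this
      linarith
    · have h1 := hC.dist_le_mul x z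
      rw [dist_eq_norm] at h1
      rw [mem_closedBall] at hx
      have : (C:ℝ) * dist x z ≤ C * ‖w‖ := by gcongr
      nlinarith [norm_nonneg w]
  refine ⟨hgc, ⟨C + 1, by positivity, fun z w => ?_⟩, ⟨C + 1, by positivity, fun z w => ?_⟩, ?_⟩
  · have := (abs_le.1 (key z w)).1
    rw [hin]; linarith
  · have := (abs_le.1 (key z w)).2
    rw [inner_neg_left, hin]; linarith
  · obtain ⟨B, hB⟩ := hdc.exists_bound_of_continuous hdf.continuous
    refine ⟨B, fun z => ?_⟩
    rw [gradient, LinearIsometryEquiv.norm_map]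
    exact hB z

lemma hasDerivAt_normSq {x : ℝ → E} {x' : E} {t : ℝ} (h : HasDerivAt x x' t) :
    HasDerivAt (fun t => ‖x t‖ ^ 2) (2 * ⟪x t, x'⟫) t := h.norm_sq

/-- uniform rotations -/
lemma rotation (hJ : ∀ x, J (J x) = -x) {x : ℝ → E} {ω : ℝ}
    (h : ∀ t, HasDerivAt x (ω • J (x t)) t) (t : ℝ) : x t = rot J (ω * t) (x 0) := by
  have hd : ∀ t, HasDerivAt (fun t => rot J (-ω * t) (x t)) 0 t := by
    intro t
    refine (hasDerivAt_rot_apply hJ (-ω) t x _ (h t)).congr_deriv ?_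
    rw [rot_smul, rot_J]; module
  have hc := is_const_of_deriv_eq_zero (fun t => (hd t).differentiableAt) (fun t => (hd t).deriv) t 0
  simp only [mul_zero, rot_zero] at hc
  rw [← hc, rot_comp hJ]
  have : ω * t + -ω * t = 0 := by ring
  rw [this, rot_zero]

lemma rotation_period (hJ : ∀ x, J (J x) = -x) {x : ℝ → E} {ω T : ℝ}
    (h : ∀ t, HasDerivAt x (ω • J (x t)) t) (hT : x T = x 0) (h0 : x 0 ≠ 0) :
    ∃ k : ℤ, k * (2 * Real.pi) = ω * T := by
  rw [← Real.cos_eq_one_iff]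
  have h1 := rotation hJ h T
  rw [hT] at h1
  have h2 : ⟪x 0, x 0⟫ = ⟪rot J (ω * T) (x 0), x 0⟫ := by rw [← h1]
  rw [rot, inner_add_left, real_inner_smul_left, real_inner_smul_left, inner_J_self hJ, mul_zero,
    add_zero, real_inner_self_eq_norm_sq] at h2
  have h3 : ‖x 0‖ ^ 2 ≠ 0 := pow_ne_zero 2 (norm_ne_zero_iff.2 h0)
  field_simp at h2
  linarith

end Ham
end HZ

namespace HZ
open MeasureTheory Filter
set_option linter.unusedSectionVars false

section Upper
variable {E : Type*} [NormedAddCommGroup E] [InnerProductSpace ℝ E] [FiniteDimensional ℝ E]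
variable {J : E ≃ₗᵢ[ℝ] E}

lemma inner_self_J (hJ : ∀ x, J (J x) = -x) (x : E) : ⟪x, J x⟫ = 0 := by
  rw [real_inner_comm, inner_J_self hJ]

/-- solutions of radial Hamiltonians stay on spheres -/
lemma radial_norm (hJ : ∀ x, J (J x) = -x) {x : ℝ → E} {f : E → ℝ}
    (h : ∀ t, HasDerivAt x (J (f (x t) • x t)) t) (t : ℝ) : ‖x t‖ = ‖x 0‖ := by
  have hd : ∀ t, HasDerivAt (fun t => ‖x t‖ ^ 2) 0 t := by
    intro t
    refine (hasDerivAt_normSq (h t)).congr_deriv ?_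
    rw [map_smul, real_inner_smul_right, inner_self_J hJ]; simp
  have hc := is_const_of_deriv_eq_zero (fun t => (hd t).differentiableAt) (fun t => (hd t).deriv) t 0
  exact (sq_eq_sq₀ (norm_nonneg _) (norm_nonneg _)).1 hc

/-- the action spectrum of the radial comparison Hamiltonian -/
lemma act_radial (hJ : ∀ x, J (J x) = -x) {A s₀ w : ℝ} (hA : 0 ≤ A) (hw : 0 < w) (hs₀ : 0 ≤ s₀)
    {F : E → ℝ} {dF : E → E} (hF : ∀ z, F z = 0) (hdF : ∀ z, dF z = 0) (x : ℝ → E)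
    (hx : IsSol J (fun z => dF z + (2 * slope A s₀ w (‖z‖ ^ 2)) • z) x)
    (hpos : 0 < act (fun z => F z + prof A s₀ w (‖z‖ ^ 2))
      (fun z => dF z + (2 * slope A s₀ w (‖z‖ ^ 2)) • z) x) :
    Real.pi * s₀ ≤ act (fun z => F z + prof A s₀ w (‖z‖ ^ 2))
      (fun z => dF z + (2 * slope A s₀ w (‖z‖ ^ 2)) • z) x := by
  obtain ⟨h1, h2⟩ := hx
  simp only [hdF, zero_add] at h1
  have hn := radial_norm hJ (f := fun z => 2 * slope A s₀ w (‖z‖ ^ 2)) h1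
  set s := ‖x 0‖ ^ 2 with hs
  have hact : act (fun z => F z + prof A s₀ w (‖z‖ ^ 2))
      (fun z => dF z + (2 * slope A s₀ w (‖z‖ ^ 2)) • z) x = slope A s₀ w s * s - prof A s₀ w s := by
    unfold act
    simp only [hdF, hF, zero_add, real_inner_smul_left, real_inner_self_eq_norm_sq, hn]
    simp only [intervalIntegral.integral_const, ← hs]
    simp; ring
  rw [hact] at hpos ⊢
  simp only [hn, map_smul] at h1
  have hle := prof_le (s₀ := s₀) hA hw s
  have hp0 := prof_nonneg (s₀ := s₀) hA hw s
  have hs0 := slope_nonneg (s₀ := s₀) (w := w) hA s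
  by_cases hx0 : x 0 = 0
  · have : s = 0 := by rw [hs, hx0]; simp
    rw [this] at hpos hp0
    simp at hpos; linarith
  · obtain ⟨k, hk⟩ := rotation_period hJ (T := 1) h1 (by have := h2 0; rwa [zero_add] at this) hx0
    have hk1 : 1 ≤ k := by
      by_contra hcon
      have : (k:ℝ) ≤ 0 := by exact_mod_cast (by omega : k ≤ 0)
      have h3 : slope A s₀ w s ≤ 0 := by nlinarith [Real.pi_pos]
      have h4 : 0 ≤ s := by positivity
      nlinarith
    have hk1' : (1:ℝ) ≤ k := by exact_mod_cast hk1
    have h5 : Real.pi ≤ slope A s₀ w s := by nlinarith [Real.pi_pos]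
    nlinarith

/-- Orbits of the extended Hamiltonian have small action. -/
lemma act_K (hJ : ∀ x, J (J x) = -x) {H : E → ℝ} {M R w a : ℝ} (hR : 0 < R) (hw : 0 < w) (ha : 0 < a)
    (hM : 0 < M) (hsub : tsupport H ⊆ ball 0 R) (hmax : ∀ z, H z ≤ M)
    (hfast : ∀ y : ℝ → E, (∀ t, HasDerivAt y (J (gradient H (y t))) t) → (∀ t, y (t + 1) = y t) →
      ∀ t, y t = y 0)
    (haw : Real.pi * R ^ 2 + Real.pi * w - M < a) (x : ℝ → E)
    (hx : IsSol J (fun z => -gradient H z +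
      (2 * slope (Real.pi * ((1:ℕ) + 1/2)) (R ^ 2) w (‖z‖ ^ 2)) • z) x) :
    act (fun z => (M - H z) + prof (Real.pi * ((1:ℕ) + 1/2)) (R ^ 2) w (‖z‖ ^ 2))
      (fun z => -gradient H z + (2 * slope (Real.pi * ((1:ℕ) + 1/2)) (R ^ 2) w (‖z‖ ^ 2)) • z) x < a := by
  obtain ⟨h1, h2⟩ := hx
  set A : ℝ := Real.pi * ((1:ℕ) + 1/2) with hAdef
  beta_reduce at h1
  have hA : 0 ≤ A := by have := Real.pi_pos; positivity
  have hxc : Continuous x := continuous_iff_continuousAt.2 fun t => (h1 t).continuousAt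
  have hg0 : ∀ z, z ∉ tsupport H → gradient H z = 0 := by
    intro z hz
    have h3 : fderiv ℝ H z = 0 := by
      by_contra hne
      exact hz (support_fderiv_subset ℝ hne)
    rw [gradient, h3, map_zero]
  have hH0 : ∀ z, z ∉ tsupport H → H z = 0 := fun z hz => image_eq_zero_of_notMem_tsupport hz
  by_cases hbig : ∃ t₀, R ≤ ‖x t₀‖
  · obtain ⟨t₀, ht₀⟩ := hbig
    set s := ‖x t₀‖ ^ 2 with hs
    have hsR : R ^ 2 ≤ s := by rw [hs]; gcongr
    have hout : ∀ z : E, ‖z‖ ^ 2 = s → z ∉ tsupport H := by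
      intro z hz hz'
      have h3 := hsub hz'
      rw [mem_ball_zero_iff] at h3
      nlinarith [norm_nonneg z]
    have hopen : IsOpen {t | ‖x t‖ ^ 2 = s} := by
      rw [Metric.isOpen_iff]
      intro t ht
      have hO : IsOpen (x ⁻¹' (tsupport H)ᶜ) := (isClosed_tsupport H).isOpen_compl.preimage hxc
      obtain ⟨ε, hε, hb⟩ := Metric.isOpen_iff.1 hO t (hout _ ht)
      refine ⟨ε, hε, fun t' ht' => ?_⟩
      have hd : ∀ u ∈ ball t ε, HasDerivAt (fun t => ‖x t‖ ^ 2) 0 u := by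
        intro u hu
        refine (hasDerivAt_normSq (h1 u)).congr_deriv ?_
        rw [hg0 _ (hb hu), neg_zero, zero_add, map_smul, real_inner_smul_right, inner_self_J hJ]; simp
      have := IsOpen.is_const_of_deriv_eq_zero (f := fun t => ‖x t‖ ^ 2) isOpen_ball
        (convex_ball t ε).isPreconnected
        (fun u hu => (hd u hu).differentiableAt.differentiableWithinAt)
        (fun u hu => (hd u hu).deriv) ht' (mem_ball_self hε)
      exact this.trans ht
    have hclosed : IsClosed {t | ‖x t‖ ^ 2 = s} := isClosed_eq (by fun_prop) continuous_const
    have huniv := IsClopen.eq_univ ⟨hclosed, hopen⟩ ⟨t₀, hs.symm⟩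
    have hall : ∀ t, ‖x t‖ ^ 2 = s := fun t => by
      have : t ∈ {t | ‖x t‖ ^ 2 = s} := by rw [huniv]; trivial
      exact this
    have hact : act (fun z => (M - H z) + prof A (R ^ 2) w (‖z‖ ^ 2))
      (fun z => -gradient H z + (2 * slope A (R ^ 2) w (‖z‖ ^ 2)) • z) x =
        slope A (R ^ 2) w s * s - M - prof A (R ^ 2) w s := by
      unfold act
      have e1 : ∀ t, gradient H (x t) = 0 := fun t => hg0 _ (hout _ (hall t))
      have e2 : ∀ t, H (x t) = 0 := fun t => hH0 _ (hout _ (hall t))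
      simp only [e1, e2, neg_zero, zero_add, real_inner_smul_left, real_inner_self_eq_norm_sq, hall]
      simp only [intervalIntegral.integral_const]
      simp; ring
    rw [hact]
    have h1' : ∀ t, HasDerivAt x ((2 * slope A (R ^ 2) w s) • J (x t)) t := by
      intro t
      have := h1 t
      rwa [hg0 _ (hout _ (hall t)), neg_zero, zero_add, hall, map_smul] at this
    have hp0 := prof_nonneg (s₀ := R ^ 2) hA hw s
    have hx0 : x 0 ≠ 0 := by
      intro h0
      have := hall 0
      rw [h0] at this
      simp at this
      have : 0 < R ^ 2 := by positivity
      linarith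
    obtain ⟨k, hk⟩ := rotation_period hJ (T := 1) h1' (by have := h2 0; rwa [zero_add] at this) hx0
    have hsl := slope_le (s₀ := R ^ 2) (w := w) hA s
    have hs0 := slope_nonneg (s₀ := R ^ 2) (w := w) hA s
    have hpi := Real.pi_pos
    have hk1 : k ≤ 1 := by
      by_contra hcon
      have : (2:ℝ) ≤ k := by exact_mod_cast (by omega : 2 ≤ k)
      have h3 : A = 3 / 2 * Real.pi := by rw [hAdef]; push_cast; ring
      nlinarith
    rcases hk1.lt_or_eq with h3 | h3
    · have h4 : (k:ℝ) ≤ 0 := by exact_mod_cast (by omega : k ≤ 0)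
      have h5 : slope A (R ^ 2) w s ≤ 0 := by nlinarith
      have h6 : slope A (R ^ 2) w s = 0 := le_antisymm h5 hs0
      rw [h6]; linarith
    · have h4 : slope A (R ^ 2) w s = Real.pi := by
        rw [h3] at hk; push_cast at hk; linarith
      have h5 : s < R ^ 2 + w := by
        by_contra hcon
        push Not at hcon
        rw [slope_top hw hcon, hAdef] at h4
        push_cast at h4
        nlinarith
      rw [h4]
      nlinarith
  · push Not at hbig
    have hsm : ∀ t, ‖x t‖ ^ 2 ≤ R ^ 2 := fun t => by have := (hbig t).le; gcongr
    have h1' : ∀ t, HasDerivAt x (J (-gradient H (x t))) t := by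
      intro t
      have := h1 t
      rwa [slope_zero hw (hsm t), mul_zero, zero_smul, add_zero] at this
    have hy := hfast (fun t => x (-t)) (fun t => by
        have h3 := (h1' (-t)).scomp t (hasDerivAt_neg t)
        refine h3.congr_deriv ?_
        simp) (fun t => by
        have := h2 (-(t + 1))
        rw [← this]; congr 1; ring)
    have hconst : ∀ t, x t = x 0 := fun t => by
      have := hy (-t)
      simpa using this
    have hg : gradient H (x 0) = 0 := by
      have h3 : HasDerivAt x 0 0 := by
        rw [show x = fun _ => x 0 from funext hconst]; exact hasDerivAt_const _ _
      have h4 := (h1' 0).unique h3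
      have h5 : J (-gradient H (x 0)) = J 0 := by rw [h4, map_zero]
      have := J.injective h5
      simpa using this
    have hact : act (fun z => (M - H z) + prof A (R ^ 2) w (‖z‖ ^ 2))
      (fun z => -gradient H z + (2 * slope A (R ^ 2) w (‖z‖ ^ 2)) • z) x = -(M - H (x 0)) := by
      unfold act
      simp only [hconst, hg, slope_zero hw (hsm 0), prof_zero hA hw (hsm 0)]
      simp
    rw [hact]
    linarith [hmax (x 0)]

theorem upper (hJ : ∀ x, J (J x) = -x) (e : E) (he : ‖e‖ = 1) {H : E → ℝ} {M r r' R : ℝ}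
    (hr : 0 < r) (hrr' : r < r') (hr'R : r' ≤ R) (hH : ContDiff ℝ (⊤ : ℕ∞) H)
    (hc : HasCompactSupport H) (hsub : tsupport H ⊆ ball 0 R)
    (hconst : ∀ z, ‖z‖ < r' → H z = M) (hmax : ∀ z, H z ≤ M)
    (hfast : ∀ y : ℝ → E, (∀ t, HasDerivAt y (J (gradient H (y t))) t) → (∀ t, y (t + 1) = y t) →
      ∀ t, y t = y 0) : M ≤ Real.pi * (R ^ 2 - r ^ 2) := by
  by_contra hcon
  push Not at hcon
  have hpi := Real.pi_pos
  have hR : 0 < R := by linarith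
  have hrR : r ^ 2 < R ^ 2 := by nlinarith
  set D := M - Real.pi * (R ^ 2 - r ^ 2) with hD
  have hD0 : 0 < D := by linarith
  have hM : 0 < M := by nlinarith
  let κ := min D (Real.pi * r ^ 2) / 4
  have hκ : 0 < κ := by positivity
  have hκ1 : 4 * κ ≤ D := by simp only [κ]; linarith [min_le_left D (Real.pi * r ^ 2)]
  have hκ2 : 4 * κ ≤ Real.pi * r ^ 2 := by
    simp only [κ]; linarith [min_le_right D (Real.pi * r ^ 2)]
  let w := κ / Real.pi
  have hw : 0 < w := by positivity
  have hπw : Real.pi * w = κ := by simp only [w]; field_simp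
  let a := Real.pi * r ^ 2 - κ
  have ha : 0 < a := by simp only [a]; linarith
  obtain ⟨B, hB⟩ := hc.exists_bound_of_continuous hH.continuous
  have hB0 : 0 ≤ B := (norm_nonneg _).trans (hB 0)
  let w' := (r' ^ 2 - r ^ 2) / 2
  have hw' : 0 < w' := by simp only [w']; nlinarith
  obtain ⟨m, hm⟩ := exists_nat_ge ((3 / 2 * Real.pi + (M + B) / w') / Real.pi)
  set A' : ℝ := Real.pi * ((m:ℝ) + 1/2) with hA'
  have hA'0 : 0 ≤ A' := by positivity
  have hA'1 : 3 / 2 * Real.pi + (M + B) / w' ≤ A' := by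
    rw [div_le_iff₀ hpi] at hm
    rw [hA']; nlinarith
  set A : ℝ := Real.pi * (((1:ℕ):ℝ) + 1/2) with hAdef
  have hA32 : A = 3 / 2 * Real.pi := by rw [hAdef]; push_cast; ring
  have hA0 : 0 ≤ A := by positivity
  obtain ⟨d1, -, ⟨L, hL, d3⟩, B', d4⟩ := smooth_desc hH hc
  have goodK := good_rad (F := fun z => M - H z) (dF := fun z => -gradient H z)
    (continuous_const.sub hH.continuous) d1.neg ⟨L, hL, fun z v => by have := d3 z v; linarith⟩
    ⟨B', fun z => by rw [norm_neg]; exact d4 z⟩ 1 (s₀ := R ^ 2) hw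
  have goodG := good_rad (F := fun _ : E => (0:ℝ)) (dF := fun _ => 0)
    continuous_const continuous_const ⟨1, one_pos, fun z v => by simp⟩
    ⟨0, fun z => by simp⟩ m (s₀ := r ^ 2) hw'
  rw [← hAdef] at goodK
  rw [← hA'] at goodG
  refine Exists.elim (minimax hJ goodK goodG (a := a) (ε := Real.pi / 2) (C₀ := A * (R ^ 2 + w))
    (r₁ := r / 2) (C' := 4 * A') ?_ ?_ (by positivity) (by positivity) ?_ (by positivity)
    (by positivity) ?_ e he ha ?_) fun x hx => ?_
  · -- comparison
    intro z
    simp only [zero_add]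
    by_cases hz : ‖z‖ < r'
    · rw [hconst z hz, sub_self, zero_add, prof_zero hA0 hw]
      · exact prof_nonneg hA'0 hw' _
      · have : ‖z‖ ≤ R := by linarith
        gcongr
    · push Not at hz
      have hzs : r' ^ 2 ≤ ‖z‖ ^ 2 := by gcongr; linarith
      have g1 := prof_ge (s₀ := r ^ 2) hA'0 hw' (‖z‖ ^ 2)
      have g2 : w' ≤ ‖z‖ ^ 2 - r ^ 2 - w' := by
        have : 2 * w' = r' ^ 2 - r ^ 2 := by simp only [w']; ring
        linarith
      have g3 : M - H z ≤ M + B := by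
        have := (abs_le.1 (hB z)).1; linarith
      have hr'R2 : r' ^ 2 ≤ R ^ 2 := by gcongr; linarith
      have g4 : prof A (R ^ 2) w (‖z‖ ^ 2) ≤ A * (‖z‖ ^ 2 - r ^ 2 - w') := by
        have hRw : r ^ 2 + w' ≤ R ^ 2 := by
          have : 2 * w' = r' ^ 2 - r ^ 2 := by simp only [w']; ring
          linarith
        rcases le_total (‖z‖ ^ 2) (R ^ 2) with h | h
        · rw [prof_zero hA0 hw h]
          exact mul_nonneg hA0 (by linarith)
        · have p1 := prof_le (s₀ := R ^ 2) hA0 hw (‖z‖ ^ 2)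
          have p2 := slope_le (s₀ := R ^ 2) (w := w) hA0 (‖z‖ ^ 2)
          have p3 := mul_le_mul_of_nonneg_right p2 (by linarith : 0 ≤ ‖z‖ ^ 2 - R ^ 2)
          have p4 := mul_le_mul_of_nonneg_left
            (by linarith : ‖z‖ ^ 2 - R ^ 2 ≤ ‖z‖ ^ 2 - r ^ 2 - w') hA0
          linarith
      have g5 : M + B ≤ (M + B) / w' * (‖z‖ ^ 2 - r ^ 2 - w') := by
        have q0 : 0 ≤ (M + B) / w' := by positivity
        have q1 : (M + B) / w' * w' = M + B := by field_simp
        have q2 := mul_le_mul_of_nonneg_left g2 q0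
        linarith
      have g6 := mul_le_mul_of_nonneg_right hA'1 (by linarith : 0 ≤ ‖z‖ ^ 2 - r ^ 2 - w')
      rw [← hA32] at g6
      linarith
  · intro z
    have := prof_nonneg (s₀ := R ^ 2) hA0 hw (‖z‖ ^ 2)
    have := hmax z
    linarith
  · intro z
    have g1 := prof_ge (s₀ := R ^ 2) hA0 hw (‖z‖ ^ 2)
    have := hmax z
    have e2 : Real.pi + Real.pi / 2 = A := by rw [hA32]; ring
    rw [e2]
    linarith
  · intro z
    simp only [zero_add]
    rcases le_total ‖z‖ r with h | h
    · rw [prof_zero hA'0 hw' (by gcongr)]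
      positivity
    · have p1 := prof_le (s₀ := r ^ 2) hA'0 hw' (‖z‖ ^ 2)
      have p2 := slope_le (s₀ := r ^ 2) (w := w') hA'0 (‖z‖ ^ 2)
      have p3 : 0 ≤ ‖z‖ ^ 2 - r ^ 2 := by nlinarith
      have p4 := mul_le_mul_of_nonneg_right p2 p3
      rw [max_eq_left (by linarith)]
      have p5 : ‖z‖ ^ 2 - r ^ 2 ≤ 4 * (‖z‖ - r / 2) ^ 2 := by nlinarith
      have p6 := mul_le_mul_of_nonneg_left p5 hA'0
      linarith
  · intro x hx h1 h2
    have := act_radial hJ hA'0 hw' (sq_nonneg r) (F := fun _ : E => (0:ℝ)) (dF := fun _ => 0)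
      (fun _ => rfl) (fun _ => rfl) x hx h1
    simp only [a] at h2
    linarith
  · have := act_K hJ hR hw ha hM hsub hmax hfast
      (by simp only [a]; rw [hπw]; nlinarith) x hx.1
    exact absurd hx.2 (not_le.2 this)

end Upper
end HZ

namespace HZ
open MeasureTheory Filter
set_option linter.unusedSectionVars false

section Lower

lemma contDiff_prof {A s₀ w : ℝ} : ContDiff ℝ (⊤ : ℕ∞) (prof A s₀ w) := by
  rw [contDiff_infty_iff_deriv]
  refine ⟨fun s => (hasDerivAt_prof s).differentiableAt, ?_⟩
  rw [show deriv (prof A s₀ w) = slope A s₀ w from funext fun s => (hasDerivAt_prof s).deriv]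
  exact contDiff_slope

lemma prof_affine {A s₀ w S s : ℝ} (hA : 0 ≤ A) (hw : 0 < w) (hS : s₀ + w ≤ S) (hs : S ≤ s) :
    prof A s₀ w s = prof A s₀ w S + A * (s - S) := by
  have h1 := prof_tangent (s₀ := s₀) hA hw S s
  have h2 := prof_tangent (s₀ := s₀) hA hw s S
  rw [slope_top hw hS] at h1
  rw [slope_top hw (hS.trans hs)] at h2
  linarith

/-- the increasing plateau function -/
def plat (B s₁ s₂ w s : ℝ) : ℝ := prof B s₁ w s - prof B s₂ w s

/-- its derivative -/
def dplat (B s₁ s₂ w s : ℝ) : ℝ := slope B s₁ w s - slope B s₂ w s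

variable {B s₁ s₂ w : ℝ}

lemma hasDerivAt_plat (s : ℝ) : HasDerivAt (plat B s₁ s₂ w) (dplat B s₁ s₂ w s) s :=
  (hasDerivAt_prof s).sub (hasDerivAt_prof s)

lemma contDiff_plat : ContDiff ℝ (⊤ : ℕ∞) (plat B s₁ s₂ w) := contDiff_prof.sub contDiff_prof

lemma dplat_nonneg (hB : 0 ≤ B) (hw : 0 < w) (h : s₁ ≤ s₂) (s : ℝ) : 0 ≤ dplat B s₁ s₂ w s := by
  have : slope B s₂ w s ≤ slope B s₁ w s := by
    unfold slope
    refine mul_le_mul_of_nonneg_left (Real.smoothTransition.monotone ?_) hB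
    gcongr
  unfold dplat
  linarith

lemma dplat_le (hB : 0 ≤ B) (s : ℝ) : dplat B s₁ s₂ w s ≤ B := by
  have h1 := slope_le (s₀ := s₁) (w := w) hB s
  have h2 := slope_nonneg (s₀ := s₂) (w := w) hB s
  unfold dplat
  linarith

lemma plat_mono (hB : 0 ≤ B) (hw : 0 < w) (h : s₁ ≤ s₂) : Monotone (plat B s₁ s₂ w) :=
  monotone_of_deriv_nonneg (fun s => (hasDerivAt_plat s).differentiableAt) fun s => by
    rw [(hasDerivAt_plat s).deriv]; exact dplat_nonneg hB hw h s

lemma plat_zero (hB : 0 ≤ B) (hw : 0 < w) (h : s₁ ≤ s₂) {s : ℝ} (hs : s ≤ s₁) :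
    plat B s₁ s₂ w s = 0 := by
  unfold plat
  rw [prof_zero hB hw hs, prof_zero hB hw (hs.trans h), sub_zero]

lemma plat_top (hB : 0 ≤ B) (hw : 0 < w) (h : s₁ ≤ s₂) {s : ℝ} (hs : s₂ + w ≤ s) :
    plat B s₁ s₂ w s = plat B s₁ s₂ w (s₂ + w) := by
  unfold plat
  rw [prof_affine hB hw (by linarith : s₁ + w ≤ s₂ + w) hs, prof_affine hB hw le_rfl hs]
  ring

lemma plat_value (hB : 0 ≤ B) (hw : 0 < w) : B * (s₂ - s₁ - w) ≤ plat B s₁ s₂ w (s₂ + w) := by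
  have h1 := prof_ge (s₀ := s₁) hB hw (s₂ + w)
  have h2 := prof_le (s₀ := s₂) hB hw (s₂ + w)
  rw [slope_top hw le_rfl] at h2
  unfold plat
  linarith

variable {E : Type*} [NormedAddCommGroup E] [InnerProductSpace ℝ E] [FiniteDimensional ℝ E]
variable {J : E ≃ₗᵢ[ℝ] E}

lemma gradient_radial {f : ℝ → ℝ} {f' : ℝ} {z : E} (h : HasDerivAt f f' (‖z‖ ^ 2)) :
    gradient (fun z => f (‖z‖ ^ 2)) z = (2 * f') • z := by
  refine HasGradientAt.gradient ?_
  rw [hasGradientAt_iff_hasFDerivAt]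
  have h1 : HasFDerivAt (fun z : E => ‖z‖ ^ 2) (2 • innerSL ℝ z) z :=
    (hasStrictFDerivAt_norm_sq z).hasFDerivAt
  refine (h.comp_hasFDerivAt z h1).congr_fderiv ?_
  ext v
  simp
  ring

theorem lower (hJ : ∀ x, J (J x) = -x) {r R η : ℝ} (hr : 0 < r) (hrR : r < R) (hη : 0 < η)
    (hη1 : η < 1) : ∃ H : E → ℝ, ContDiff ℝ (⊤ : ℕ∞) H ∧ IsCompact (tsupport H) ∧
      tsupport H ⊆ ball 0 R ∧ (∃ U, IsOpen U ∧ closedBall 0 r ⊆ U ∧ ∃ c : ℝ, ∀ x ∈ U, H x = c) ∧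
      (∀ z ∈ closedBall (0:E) r, ∀ x, H x ≤ H z) ∧
      Real.pi * (R ^ 2 - r ^ 2) * (1 - 2 * η) ≤ H 0 ∧
      ∀ (y : ℝ → E) (T : ℝ), 0 < T → T ≤ 1 → (∀ t, HasDerivAt y (J (gradient H (y t))) t) →
        (∀ t, y (t + T) = y t) → ∀ t, y t = y 0 := by
  have hpi := Real.pi_pos
  have hd : 0 < R ^ 2 - r ^ 2 := by nlinarith
  obtain ⟨w, hwdef⟩ : ∃ w, w = η * (R ^ 2 - r ^ 2) / 8 := ⟨_, rfl⟩
  have hw : 0 < w := by rw [hwdef]; positivity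
  have hw8 : 8 * w < R ^ 2 - r ^ 2 := by rw [hwdef]; nlinarith
  obtain ⟨B, hBdef⟩ : ∃ B, B = Real.pi * (1 - η) := ⟨_, rfl⟩
  have hB : 0 ≤ B := by rw [hBdef]; nlinarith
  have hBpi : B < Real.pi := by rw [hBdef]; nlinarith
  let s₁ := r ^ 2 + w
  let s₂ := R ^ 2 - 2 * w
  have h12 : s₁ ≤ s₂ := by simp only [s₁, s₂]; linarith
  have hs2w : s₂ + w = R ^ 2 - w := by simp only [s₂]; ring
  let c := plat B s₁ s₂ w (s₂ + w)
  let f : ℝ → ℝ := fun s => c - plat B s₁ s₂ w s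
  have hf : ∀ s, HasDerivAt f (-dplat B s₁ s₂ w s) s := fun s => by
    simpa using (hasDerivAt_plat s).const_sub c
  let H : E → ℝ := fun z => f (‖z‖ ^ 2)
  have hclosed : IsClosed {z : E | ‖z‖ ^ 2 ≤ R ^ 2 - w} :=
    isClosed_le (by fun_prop) continuous_const
  have hsupp : tsupport H ⊆ {z : E | ‖z‖ ^ 2 ≤ R ^ 2 - w} := by
    refine closure_minimal ?_ hclosed
    intro z hz
    by_contra hcon
    simp only [mem_ofPred_eq, not_le] at hcon
    refine hz ?_
    simp only [H, f, c]
    have h3 : s₂ + w ≤ ‖z‖ ^ 2 := by rw [hs2w]; exact hcon.le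
    rw [plat_top hB hw h12 h3, sub_self]
  have hsub : tsupport H ⊆ ball 0 R := by
    intro z hz
    have := hsupp hz
    rw [mem_ball_zero_iff]
    simp only [mem_ofPred_eq] at this
    nlinarith [norm_nonneg z]
  have hsmall : ∀ z : E, ‖z‖ ^ 2 ≤ s₁ → H z = c := fun z hz => by
    simp only [H, f]
    rw [plat_zero hB hw h12 hz, sub_zero]
  refine ⟨H, ?_, ?_, hsub, ?_, ?_, ?_, ?_⟩
  · exact (contDiff_const.sub contDiff_plat).comp (contDiff_norm_sq ℝ)
  · exact (isCompact_closedBall (0:E) R).of_isClosed_subset (isClosed_tsupport H)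
      (hsub.trans ball_subset_closedBall)
  · refine ⟨{z : E | ‖z‖ ^ 2 < s₁}, isOpen_lt (by fun_prop) continuous_const, ?_, c,
      fun z hz => hsmall z (le_of_lt hz)⟩
    intro z hz
    rw [mem_closedBall_zero_iff] at hz
    have : ‖z‖ ^ 2 ≤ r ^ 2 := by gcongr
    simp only [mem_ofPred_eq, s₁]
    linarith
  · intro z hz x
    rw [mem_closedBall_zero_iff] at hz
    have : ‖z‖ ^ 2 ≤ r ^ 2 := by gcongr
    rw [hsmall z (by simp only [s₁]; linarith)]
    simp only [H, f]
    have h1 := plat_mono hB hw h12 (sq_nonneg ‖x‖)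
    have h2 : (0:ℝ) ≤ s₁ := by simp only [s₁]; positivity
    rw [plat_zero hB hw h12 h2] at h1
    linarith
  · have h3 : ‖(0:E)‖ ^ 2 ≤ s₁ := by
      rw [norm_zero, zero_pow two_ne_zero]; simp only [s₁]; positivity
    rw [hsmall 0 h3]
    refine le_trans ?_ (plat_value hB hw)
    have e : s₂ - s₁ - w = (R ^ 2 - r ^ 2) * (1 - η / 2) := by
      simp only [s₁, s₂]; rw [hwdef]; ring
    rw [e, hBdef]
    have : 0 < Real.pi * (R ^ 2 - r ^ 2) := by positivity
    have h2 : 1 - 2 * η ≤ (1 - η) * (1 - η / 2) := by nlinarith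
    have := mul_le_mul_of_nonneg_left h2 this.le
    linarith
  · intro y T hT hT1 hy hper t
    have hg : ∀ z, gradient H z = (2 * -dplat B s₁ s₂ w (‖z‖ ^ 2)) • z :=
      fun z => gradient_radial (hf _)
    simp only [hg] at hy
    have hn := radial_norm hJ (f := fun z => 2 * -dplat B s₁ s₂ w (‖z‖ ^ 2)) hy
    simp only [hn, map_smul] at hy
    have hrot := rotation hJ hy t
    by_cases h0 : y 0 = 0
    · have := hn t
      rw [h0, norm_zero, norm_eq_zero] at this
      rw [this, h0]
    · obtain ⟨k, hk⟩ := rotation_period hJ (T := T) hy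
        (by have := hper 0; rwa [zero_add] at this) h0
      have d1 := dplat_nonneg hB hw h12 (‖y 0‖ ^ 2)
      have d2 := dplat_le (s₁ := s₁) (s₂ := s₂) (w := w) hB (‖y 0‖ ^ 2)
      set d := dplat B s₁ s₂ w (‖y 0‖ ^ 2) with hddef
      have d3 : d * T < Real.pi := by nlinarith
      have d4 : 0 ≤ d * T := by positivity
      have k1 : (-1:ℝ) < k := by nlinarith
      have k2 : (k:ℝ) < 1 := by nlinarith
      have k3 : k = 0 := by
        have k1' : (-1:ℤ) < k := by exact_mod_cast k1
        have k2' : k < 1 := by exact_mod_cast k2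
        omega
      rw [k3] at hk
      have hd0 : d = 0 := by
        have : d * T = 0 := by push_cast at hk; linarith
        rcases mul_eq_zero.1 this with h | h
        · exact h
        · exact absurd h hT.ne'
      rw [hrot, hd0]
      simp [rot]

end Lower
end HZ

namespace HZ

/-- multiplication by `i` as a real linear isometry of `ℂ^n` -/
def Jn : Esp n ≃ₗᵢ[ℝ] Esp n where
  toFun x := Complex.I • x
  invFun x := (-Complex.I) • x
  map_add' x y := smul_add _ _ _
  map_smul' a x := smul_comm _ _ _
  left_inv x := by simp [smul_smul]
  right_inv x := by simp [smul_smul]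
  norm_map' x := by
    change ‖Complex.I • x‖ = ‖x‖
    rw [norm_smul, Complex.norm_I, one_mul]

lemma Jn_Jn (x : Esp n) : Jn (Jn x) = -x := by
  change Complex.I • Complex.I • x = -x
  rw [smul_smul, Complex.I_mul_I, neg_one_smul]

end HZ

/-- **Example 5.4 of Ginzburg–Gürel**: for `0 < r < R`, the relative
Hofer–Zehnder capacity of the open ball `B_R ⊂ ℝ^{2n}` relative to the closed
ball `B̄_r` is `π (R² - r²)`. -/
theorem stmt_8 (n : ℕ) (hn : 1 ≤ n) (r R : ℝ) (hr : 0 < r) (hrR : r < R) :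
    relCap (ball (0 : Esp n) R) (closedBall (0 : Esp n) r) =
      ENNReal.ofReal (Real.pi * (R ^ 2 - r ^ 2)) := by
  have hcap : relCap (ball (0 : Esp n) R) (closedBall (0 : Esp n) r) ≤
      ENNReal.ofReal (Real.pi * (R ^ 2 - r ^ 2)) := by
    refine sSup_le ?_
    rintro c ⟨H, ⟨hH, hcpt, hsub, ⟨U, hU, hZU, c₀, hc₀⟩, hmax⟩, hfast, z, hz, rfl⟩
    refine ENNReal.ofReal_le_ofReal ?_
    obtain ⟨δ, hδ, hth⟩ := (isCompact_closedBall (0 : Esp n) r).exists_thickening_subset_open hU hZU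
    rw [thickening_closedBall hδ hr.le] at hth
    refine HZ.upper (HZ.Jn_Jn (n := n)) (EuclideanSpace.single ⟨0, hn⟩ (1:ℂ)) (by simp) (H := H)
      (r' := min (δ + r) R) hr (lt_min (by linarith) hrR) (min_le_right _ _) hH hcpt hsub ?_
      (hmax z hz) ?_
    · intro x hx
      rw [hc₀ z (hZU hz), hc₀ x (hth ?_)]
      rw [mem_ball_zero_iff]
      exact lt_of_lt_of_le hx (min_le_left _ _)
    · intro y hy hper
      by_contra hcon
      push Not at hcon
      obtain ⟨t, ht⟩ := hcon
      exact hfast ⟨y, 1, ⟨one_pos, hy, hper, t, 0, ht⟩, le_rfl⟩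
  refine le_antisymm hcap ?_
  by_contra hlt
  push Not at hlt
  have hpi := Real.pi_pos
  have hd : 0 < Real.pi * (R ^ 2 - r ^ 2) := mul_pos hpi (by nlinarith)
  set D := Real.pi * (R ^ 2 - r ^ 2) with hD
  set C := (relCap (ball (0 : Esp n) R) (closedBall (0 : Esp n) r)).toReal with hC
  have hne : relCap (ball (0 : Esp n) R) (closedBall (0 : Esp n) r) ≠ ⊤ := hlt.ne_top
  have hCD : C < D := (ENNReal.lt_ofReal_iff_toReal_lt hne).1 hlt
  have hC0 : 0 ≤ C := ENNReal.toReal_nonneg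
  obtain ⟨η, hη⟩ : ∃ η, η = (D - C) / (4 * D) := ⟨_, rfl⟩
  have hη0 : 0 < η := by rw [hη]; exact div_pos (by linarith) (by linarith)
  have hη4 : 4 * (D * η) = D - C := by rw [hη]; field_simp
  have hη1 : η < 1 := by rw [hη, div_lt_one (by linarith)]; linarith
  obtain ⟨H, hH, hcpt, hsub, hU, hmax, hval, hno⟩ :=
    HZ.lower (HZ.Jn_Jn (n := n)) (r := r) (R := R) hr hrR hη0 hη1
  rw [← hD] at hval
  have hmem : ENNReal.ofReal (H 0) ≤ relCap (ball (0 : Esp n) R) (closedBall (0 : Esp n) r) := by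
    refine le_sSup ⟨H, ⟨hH, hcpt, hsub, hU, hmax⟩, ?_, 0, mem_closedBall_self hr.le, rfl⟩
    rintro ⟨γ, T, ⟨hT, hode, hper, t₀, t₁, hne'⟩, hT1⟩
    have h1 := hno γ T hT hT1 hode hper
    exact hne' ((h1 t₀).trans (h1 t₁).symm)
  have := (ENNReal.ofReal_le_iff_le_toReal hne).1 hmem
  rw [← hC] at this
  nlinarith
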